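/- arXiv:math/0111148 — 2 statements merged into one kernel-verified Lean document; each statement's English description precedes it below -/
import Mathlib

section
/- For derivations X_1,…,X_m, Y_1,…,Y_n ∈ ADer^0(V) of the commutative algebra V, the Nijenhuis–Richardson bracket of the wedge products expands as [X_1∧…∧X_m, Y_1∧…∧Y_n]^{NR} = Σ_{k=1}^m Σ_{l=1}^n (−1)^{k+l} [X_k,Y_l]∧X_1∧…∧X̂_k∧…∧X_m∧Y_1∧…∧Ŷ_l∧…∧Y_n, where [X_k,Y_l] = X_k∘Y_l − Y_l∘X_k is the commutator of derivations and hats denote omitted factors. -/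
/-!  Common framework: operations of degree `a ≥ -1` on a vector space `V`
(i.e. `(a+1)`-linear maps `V^{a+1} → V`) are encoded as raw functions
`(ℕ → V) → V` depending only on the first `a+1` entries of the argument
sequence, together with explicit multilinearity/alternation predicates. -/

noncomputable section
open scoped Classical

namespace JacobiRevisited

/-- Raw operations on `V`: an `n`-ary operation is encoded by its action on
infinite sequences of arguments (using only the first `n` of them). -/
abbrev Op (V : Type*) := (ℕ → V) → V

/-- `A` depends only on the first `n` arguments. -/
def DependsOn {V : Type*} (n : ℕ) (A : Op V) : Prop :=
  ∀ x y : ℕ → V, (∀ i, i < n → x i = y i) → A x = A y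

/-- `A` is an `n`-linear map `V^n → V` (encoded on sequences): it depends only on
the first `n` arguments and is `k`-linear in each of them. -/
def IsMultilinearOn (k : Type*) {V : Type*} [Semiring k] [AddCommMonoid V]
    [Module k V] (n : ℕ) (A : Op V) : Prop :=
  DependsOn n A ∧
    ∀ i, i < n →
      (∀ (x : ℕ → V) (c : k) (v : V),
        A (Function.update x i (c • v)) = c • A (Function.update x i v)) ∧
      (∀ (x : ℕ → V) (v w : V),
        A (Function.update x i (v + w)) =
          A (Function.update x i v) + A (Function.update x i w))

/-- `A` is alternating in its first `n` arguments. -/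
def IsAlternatingOn {V : Type*} [Zero V] (n : ℕ) (A : Op V) : Prop :=
  ∀ x : ℕ → V, ∀ i j, i < n → j < n → i ≠ j → x i = x j → A x = 0

/-- The number of arguments of an operation of degree `a` (namely `a+1`). -/
def ar (a : ℤ) : ℕ := (a + 1).toNat

/-- Membership in `M^a(V)`: an `(a+1)`-linear map `V^{a+1} → V`
(for `a = -1` this is just a constant, i.e. an element of `V`). -/
def MemM (k : Type*) {V : Type*} [Semiring k] [AddCommMonoid V] [Module k V]
    (a : ℤ) (A : Op V) : Prop := IsMultilinearOn k (ar a) A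

/-- Membership in `A^a(V)`: an alternating `(a+1)`-linear map `V^{a+1} → V`. -/
def MemA (k : Type*) {V : Type*} [Semiring k] [AddCommMonoid V] [Module k V]
    (a : ℤ) (A : Op V) : Prop :=
  IsMultilinearOn k (ar a) A ∧ IsAlternatingOn (ar a) A

/-- The argument sequence `x_0, …, x_{m-1}, B(x_m,…,x_{m+nB-1}), x_{m+nB}, …`
(arguments for the outer operation after inserting the `nB`-ary `B`
at slot `m`). -/
def insertArg {V : Type*} (B : Op V) (nB m : ℕ) (x : ℕ → V) : ℕ → V := fun j =>
  if j < m then x j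
  else if j = m then B fun i => x (m + i)
  else x (j + nB - 1)

/-- The Gerstenhaber insertion `ι_B A` of `B ∈ M^b(V)` into `A ∈ M^a(V)`:
`ι_B A(x_0,…,x_{a+b}) = Σ_{m=0}^{a} (−1)^{b·m} A(x_0,…,x_{m−1},
B(x_m,…,x_{m+b}), x_{m+b+1},…,x_{a+b})`. -/
def gIns {V : Type*} [AddCommGroup V] (a b : ℤ) (A B : Op V) : Op V := fun x =>
  ∑ m ∈ Finset.range (ar a),
    (((-1 : ℤˣ) ^ (b * (m : ℤ)) : ℤˣ) : ℤ) • A (insertArg B (ar b) m x)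

/-- The Gerstenhaber bracket `[A,B]^G = −ι_A B + (−1)^{ab} ι_B A` of
`A ∈ M^a(V)` and `B ∈ M^b(V)`. -/
def gBracket {V : Type*} [AddCommGroup V] (a b : ℤ) (A B : Op V) : Op V :=
  -(gIns b a B A) + (((-1 : ℤˣ) ^ (a * b) : ℤˣ) : ℤ) • gIns a b A B

/-- The set `S(n-1, p-1)` of unshuffle permutations of `{0,…,n-1}` which are
strictly increasing on the first `p` positions and on the remaining ones. -/
def Unshuffles (n p : ℕ) : Finset (Equiv.Perm (Fin n)) :=
  Finset.univ.filter fun σ =>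
    (∀ i j : Fin n, (i : ℕ) < (j : ℕ) → (j : ℕ) < p → σ i < σ j) ∧
    (∀ i j : Fin n, (i : ℕ) < (j : ℕ) → p ≤ (i : ℕ) → σ i < σ j)

/-- The Nijenhuis–Richardson insertion `i_B A` of the `nB`-ary `B` into the
`nA`-ary `A`:
`i_B A(x_0,…,x_{a+b}) = Σ_{σ ∈ S(a+b,b)} sgn(σ) ·
A(B(x_{σ(0)},…,x_{σ(b)}), x_{σ(b+1)},…,x_{σ(a+b)})`
(and `i_B A = 0` when `A` has degree `-1`, i.e. no argument slots). -/
def nrIns {V : Type*} [AddCommGroup V] (nA nB : ℕ) (A B : Op V) : Op V := fun x =>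
  if hA : nA = 0 then 0
  else
    ∑ σ ∈ Unshuffles (nA + nB - 1) nB,
      ((Equiv.Perm.sign σ : ℤˣ) : ℤ) •
        A fun j =>
          if hj0 : j = 0 then
            B fun i => if hi : i < nB then x (σ ⟨i, by omega⟩) else 0
          else if hj : j < nA then x (σ ⟨nB + j - 1, by omega⟩) else 0

/-- The Nijenhuis–Richardson bracket `[A,B]^{NR} = −i_A B + (−1)^{ab} i_B A`
of `A ∈ A^a(V)` and `B ∈ A^b(V)`. -/
def nrBracket {V : Type*} [AddCommGroup V] (a b : ℤ) (A B : Op V) : Op V :=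
  -(nrIns (ar b) (ar a) B A) +
    (((-1 : ℤˣ) ^ (a * b) : ℤˣ) : ℤ) • nrIns (ar a) (ar b) A B

/-- The wedge product `A∧B` of the `nA`-ary `A` and the `nB`-ary `B`
(over a commutative algebra `V`):
`(A∧B)(x_0,…,x_{a+b+1}) = Σ_σ sgn(σ) · A(x_{σ(0)},…,x_{σ(a)}) ·
B(x_{σ(a+1)},…,x_{σ(a+b+1)})` summed over unshuffles. -/
def wedge {V : Type*} [CommRing V] (nA nB : ℕ) (A B : Op V) : Op V := fun x =>
  ∑ σ ∈ Unshuffles (nA + nB) nA,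
    ((Equiv.Perm.sign σ : ℤˣ) : ℤ) •
      (A (fun i => if hi : i < nA then x (σ ⟨i, by omega⟩) else 0) *
        B fun j => if hj : j < nB then x (σ ⟨nA + j, by omega⟩) else 0)

/-- The argument sequence `v, x_0, x_1, …`. -/
def consV {V : Type*} (v : V) (x : ℕ → V) : ℕ → V := fun n =>
  if n = 0 then v else x (n - 1)

/-- The argument sequence `v, w, 0, 0, …` (for applying binary operations). -/
def duo {V : Type*} [Zero V] (v w : V) : ℕ → V := fun n =>
  if n = 0 then v else if n = 1 then w else 0

/-- Membership in `ADer^a(V)`: an alternating `(a+1)`-linear map which (for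
`a ≥ 0`) is a derivation in its first (hence, by skew-symmetry, in each)
argument; `ADer^{-1}(V) = V`. -/
def MemADer (k : Type*) {V : Type*} [CommRing k] [CommRing V] [Algebra k V]
    (a : ℤ) (A : Op V) : Prop :=
  IsMultilinearOn k (ar a) A ∧ IsAlternatingOn (ar a) A ∧
    (0 ≤ a → ∀ (f g : V) (x : ℕ → V),
      A (consV (f * g) x) = f * A (consV g x) + g * A (consV f x))

/-- Membership in `ADiff_1^a(V)`: an alternating `(a+1)`-linear map which (for
`a ≥ 0`) is a first-order differential operator in its first (hence in each)
argument; `ADiff_1^{-1}(V) = V`. -/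
def MemADiff1 (k : Type*) {V : Type*} [CommRing k] [CommRing V] [Algebra k V]
    (a : ℤ) (A : Op V) : Prop :=
  IsMultilinearOn k (ar a) A ∧ IsAlternatingOn (ar a) A ∧
    (0 ≤ a → ∀ (f g : V) (x : ℕ → V),
      A (consV (f * g) x) =
        f * A (consV g x) + g * A (consV f x) - f * g * A (consV 1 x))

/-- `D : V → V` is a differential operator of order `≤ n` on the commutative
algebra `V`. -/
def DiffOrderLe {V : Type*} [CommRing V] : ℕ → (V → V) → Prop
  | 0 => fun D => ∀ f x, D (f * x) = f * D x
  | n + 1 => fun D => ∀ f : V, DiffOrderLe n fun x => D (f * x) - f * D x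

/-- Membership in `ADiff^a(V)`: an alternating `(a+1)`-linear map which is a
differential operator of some finite order in each argument separately
(the other arguments being fixed); `ADiff^{-1}(V) = V`. -/
def MemADiff (k : Type*) {V : Type*} [CommRing k] [CommRing V] [Algebra k V]
    (a : ℤ) (A : Op V) : Prop :=
  IsMultilinearOn k (ar a) A ∧ IsAlternatingOn (ar a) A ∧
    ∀ i, i < ar a → ∃ n, ∀ x : ℕ → V,
      DiffOrderLe n fun v => A (Function.update x i v)

/-- The identity map `I ∈ A^0(V)`. -/
def Iop {V : Type*} : Op V := fun x => x 0

/-- The insertion `i_1 A` of the unit `1 ∈ V = A^{-1}(V)` into `A ∈ A^a(V)`;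
for `a ≥ 0` this is `A(1,·,…,·)`. -/
def iUnit {V : Type*} [CommRing V] (a : ℤ) (A : Op V) : Op V :=
  nrIns (ar a) 0 A fun _ => 1

/-- Application of a degree-0 (i.e. unary) operation to an element of `V`. -/
def app1 {V : Type*} (X : Op V) (v : V) : V := X fun _ => v

/-- The commutator `X∘Y − Y∘X` of two degree-0 operations. -/
def commOp {V : Type*} [AddCommGroup V] (X Y : Op V) : Op V := fun x =>
  app1 X (app1 Y (x 0)) - app1 Y (app1 X (x 0))

/-- The iterated wedge product `X_1 ∧ … ∧ X_m` of a list of degree-0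
operations (with the empty product being the unit `1 ∈ V = A^{-1}(V)`). -/
def wedgeList {V : Type*} [CommRing V] : List (Op V) → Op V
  | [] => fun _ => 1
  | X :: l => wedge 1 l.length X (wedgeList l)


/-- The `n`-ary operation `x ↦ det (f i (x j))` built from unary operations `f i`. -/
def detOp {V : Type*} [CommRing V] (n : ℕ) (f : ℕ → Op V) : Op V := fun x =>
  (Matrix.of fun j i : Fin n => app1 (f i) (x j)).det

/-- The first `n` entries of a sequence, followed by zeros. -/
def trunc {V : Type*} [Zero V] (n : ℕ) (x : ℕ → V) : ℕ → V := fun i => if i < n then x i else 0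

/-- The first `n` entries of a sequence, permuted by `σ`, followed by zeros. -/
def permArg {V : Type*} [Zero V] {n : ℕ} (σ : Equiv.Perm (Fin n)) (x : ℕ → V) : ℕ → V := fun i =>
  if h : i < n then x (σ ⟨i, h⟩) else 0

/-- The signed sum of `Φ` over the `(p, n - p)`-unshuffles of the first `n` arguments. -/
def unshuffleSum {V : Type*} [AddCommGroup V] (n p : ℕ) (Φ : Op V) : Op V := fun x =>
  ∑ σ ∈ Unshuffles n p, ((Equiv.Perm.sign σ : ℤˣ) : ℤ) • Φ (permArg σ x)

/-- The composition of two unary operations. -/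
def compOp {V : Type*} (X Y : Op V) : Op V := fun x => app1 X (app1 Y (x 0))

section Unshuffles

variable {p q : ℕ}

/-- The permutation of `Fin (p + q)` acting by `α` on the first `p` and by `β` on the last `q`
elements. -/
def blockPerm (α : Equiv.Perm (Fin p)) (β : Equiv.Perm (Fin q)) : Equiv.Perm (Fin (p + q)) :=
  finSumFinEquiv.permCongr (Equiv.Perm.sumCongr α β)

theorem blockPerm_castAdd (α : Equiv.Perm (Fin p)) (β : Equiv.Perm (Fin q)) (i : Fin p) :
    blockPerm α β (Fin.castAdd q i) = Fin.castAdd q (α i) := by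
  simp [blockPerm, Equiv.permCongr_apply]

theorem blockPerm_natAdd (α : Equiv.Perm (Fin p)) (β : Equiv.Perm (Fin q)) (i : Fin q) :
    blockPerm α β (Fin.natAdd p i) = Fin.natAdd p (β i) := by
  simp [blockPerm, Equiv.permCongr_apply]

theorem sign_blockPerm (α : Equiv.Perm (Fin p)) (β : Equiv.Perm (Fin q)) :
    Equiv.Perm.sign (blockPerm α β) = Equiv.Perm.sign α * Equiv.Perm.sign β := by
  simp [blockPerm]

theorem mem_unshuffles {σ : Equiv.Perm (Fin (p + q))} :
    σ ∈ Unshuffles (p + q) p ↔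
      StrictMono (fun i => σ (Fin.castAdd q i)) ∧ StrictMono (fun i => σ (Fin.natAdd p i)) := by
  simp only [Unshuffles, Finset.mem_filter, Finset.mem_univ, true_and]
  refine and_congr ⟨fun h i j hij => h _ _ hij j.2, fun h i j hij hj => ?_⟩
    ⟨fun h i j hij => h _ _ (by simpa using hij) (by simp), fun h i j hij hi => ?_⟩
  · exact @h ⟨i, by omega⟩ ⟨j, hj⟩ hij
  · have := @h ⟨i - p, by omega⟩ ⟨j - p, by omega⟩ (by simp only [Fin.mk_lt_mk]; omega)
    have e (t : Fin (p + q)) (ht : p ≤ t) : Fin.natAdd p ⟨t - p, by omega⟩ = t := by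
      ext; simp; omega
    simpa only [e i hi, e j (by omega)] using this

theorem injective_unshuffle_mul_blockPerm
    {σ τ : Equiv.Perm (Fin (p + q))} (hσ : σ ∈ Unshuffles (p + q) p)
    (hτ : τ ∈ Unshuffles (p + q) p) {α γ : Equiv.Perm (Fin p)} {β δ : Equiv.Perm (Fin q)}
    (h : σ * blockPerm α β = τ * blockPerm γ δ) : σ = τ ∧ α = γ ∧ β = δ := by
  rw [mem_unshuffles] at hσ hτ
  have h₁ (i : Fin p) : σ (Fin.castAdd q (α i)) = τ (Fin.castAdd q (γ i)) := by
    simpa [blockPerm_castAdd] using Equiv.congr_fun h (Fin.castAdd q i)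
  have h₂ (i : Fin q) : σ (Fin.natAdd p (β i)) = τ (Fin.natAdd p (δ i)) := by
    simpa [blockPerm_natAdd] using Equiv.congr_fun h (Fin.natAdd p i)
  have e₁ : (fun i => σ (Fin.castAdd q i)) = fun i => τ (Fin.castAdd q i) := by
    refine (hσ.1.range_inj hτ.1).1 ?_
    rw [← α.surjective.range_comp, ← γ.surjective.range_comp (fun i => τ (Fin.castAdd q i))]
    exact congrArg Set.range (funext h₁)
  have e₂ : (fun i => σ (Fin.natAdd p i)) = fun i => τ (Fin.natAdd p i) := by
    refine (hσ.2.range_inj hτ.2).1 ?_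
    rw [← β.surjective.range_comp, ← δ.surjective.range_comp (fun i => τ (Fin.natAdd p i))]
    exact congrArg Set.range (funext h₂)
  have e : σ = τ := by
    ext i : 1
    induction i using Fin.addCases with
    | left i => exact congrFun e₁ i
    | right i => exact congrFun e₂ i
  subst e
  exact ⟨rfl, Equiv.ext fun i => by simpa using h₁ i, Equiv.ext fun i => by simpa using h₂ i⟩

theorem exists_unshuffle_mul_blockPerm (ρ : Equiv.Perm (Fin (p + q))) :
    ∃ σ ∈ Unshuffles (p + q) p, ∃ (α : Equiv.Perm (Fin p)) (β : Equiv.Perm (Fin q)),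
      σ * blockPerm α β = ρ := by
  let α := Tuple.sort fun i => ρ (Fin.castAdd q i)
  let β := Tuple.sort fun i => ρ (Fin.natAdd p i)
  refine ⟨ρ * blockPerm α β, mem_unshuffles.2 ⟨?_, ?_⟩, α⁻¹, β⁻¹, ?_⟩
  · refine Monotone.strictMono_of_injective (fun i j hij => ?_) fun i j => by simp
    simpa [blockPerm_castAdd] using Tuple.monotone_sort (fun i => ρ (Fin.castAdd q i)) hij
  · refine Monotone.strictMono_of_injective (fun i j hij => ?_) fun i j => by simp
    simpa [blockPerm_natAdd] using Tuple.monotone_sort (fun i => ρ (Fin.natAdd p i)) hij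
  · ext i : 1
    induction i using Fin.addCases <;> simp [blockPerm_castAdd, blockPerm_natAdd]

/-- Laplace expansion along the first `p` columns. -/
theorem det_eq_sum_unshuffles {R : Type*} [CommRing R]
    (M : Matrix (Fin (p + q)) (Fin (p + q)) R) :
    M.det = ∑ σ ∈ Unshuffles (p + q) p, ((Equiv.Perm.sign σ : ℤˣ) : ℤ) •
      ((M.submatrix (fun i => σ (Fin.castAdd q i)) (Fin.castAdd q)).det *
        (M.submatrix (fun i => σ (Fin.natAdd p i)) (Fin.natAdd p)).det) := by
  simp only [Matrix.det_apply', Finset.sum_mul_sum, Finset.smul_sum]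
  simp only [← Finset.sum_product']
  symm
  refine Finset.sum_nbij (fun t => t.1 * blockPerm t.2.1 t.2.2) ?_ ?_ ?_ ?_
  · simp
  · rintro ⟨σ, α, β⟩ h ⟨τ, γ, δ⟩ h' e
    simp only [Finset.coe_product, Set.mem_prod, Finset.mem_coe] at h h'
    obtain ⟨rfl, rfl, rfl⟩ := injective_unshuffle_mul_blockPerm h.1 h'.1 e
    rfl
  · intro ρ _
    obtain ⟨σ, hσ, α, β, h⟩ := exists_unshuffle_mul_blockPerm ρ
    exact ⟨(σ, α, β), by simpa using hσ, h⟩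
  · rintro ⟨σ, α, β⟩ _
    simp only [Matrix.submatrix_apply, Fin.prod_univ_add, Equiv.Perm.mul_apply,
      blockPerm_castAdd, blockPerm_natAdd, Equiv.Perm.sign_mul, sign_blockPerm, zsmul_eq_mul]
    push_cast
    ring

end Unshuffles

section WedgeList

variable {V : Type*} [CommRing V]

theorem DependsOn.app1_eq {V : Type*} {X : Op V} (hX : DependsOn 1 X) (x : ℕ → V) :
    X x = app1 X (x 0) :=
  hX _ _ fun i hi => by simp [Nat.lt_one_iff.1 hi]

theorem wedge_eq_unshuffleSum (p q : ℕ) (A B : Op V) :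
    wedge p q A B =
      unshuffleSum (p + q) p fun y => A (trunc p y) * B (trunc q fun j => y (p + j)) := by
  funext x
  refine Finset.sum_congr rfl fun σ _ => ?_
  congr 3 <;> funext i <;> simp only [trunc, permArg] <;> split_ifs <;> first | rfl | omega

theorem nrIns_eq_unshuffleSum (p q : ℕ) (A B : Op V) :
    nrIns (p + 1) q A B =
      unshuffleSum (q + p) q fun y => A (consV (B (trunc q y)) (trunc p fun j => y (q + j))) := by
  have h : q + p = p + 1 + q - 1 := by omega
  rw [h]
  funext x
  rw [nrIns, dif_neg p.succ_ne_zero]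
  refine Finset.sum_congr rfl fun σ _ => ?_
  congr 2
  funext j
  rcases j with _ | j
  · simp only [consV, dite_true, if_true]
    congr 1
    funext i
    simp only [trunc, permArg]
    split_ifs <;> first | rfl | omega
  · simp only [consV, trunc, permArg, Nat.add_sub_cancel, ← add_assoc]
    split_ifs <;> first | rfl | omega | contradiction

theorem wedge_detOp (p q : ℕ) (f g : ℕ → Op V) :
    wedge p q (detOp p f) (detOp q g) =
      detOp (p + q) fun i => if i < p then f i else g (i - p) := by
  funext x
  rw [wedge_eq_unshuffleSum, detOp, det_eq_sum_unshuffles]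
  refine Finset.sum_congr rfl fun σ _ => ?_
  simp only [detOp]
  congr 3 <;> ext j i
  · simp [trunc, permArg, show (j : ℕ) < p + q by omega]
    rfl
  · simp [trunc, permArg]
    rfl

theorem wedgeList_eq_detOp {L : List (Op V)} (hL : ∀ X ∈ L, DependsOn 1 X) :
    wedgeList L = detOp L.length fun i => L.getD i 0 := by
  induction L with
  | nil => funext x; simp [wedgeList, detOp]
  | cons X L ih =>
    have hX : X = detOp 1 fun _ => X := by
      funext x
      simp [detOp, (hL X List.mem_cons_self).app1_eq x]
    rw [wedgeList, ih fun Y hY => hL Y (List.mem_cons_of_mem _ hY)]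
    conv_lhs => rw [hX]
    rw [wedge_detOp, add_comm]
    congr 1
    funext i
    rcases i with _ | i <;> simp

theorem wedge_wedgeList {L M : List (Op V)} {p q : ℕ} (hp : L.length = p) (hq : M.length = q)
    (hL : ∀ X ∈ L, DependsOn 1 X) (hM : ∀ X ∈ M, DependsOn 1 X) :
    wedge p q (wedgeList L) (wedgeList M) = wedgeList (L ++ M) := by
  subst hp hq
  have hLM : ∀ X ∈ L ++ M, DependsOn 1 X := fun X hX =>
    (List.mem_append.1 hX).elim (hL X) (hM X)
  rw [wedgeList_eq_detOp hL, wedgeList_eq_detOp hM, wedgeList_eq_detOp hLM, wedge_detOp,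
    List.length_append]
  congr 1
  funext i
  split_ifs with h
  · rw [List.getD_append _ _ _ _ h]
  · rw [List.getD_append_right _ _ _ _ (not_lt.1 h)]

/-- The wedge product as a biadditive map. -/
def wedgeHom (p q : ℕ) : Op V →ₗ[ℤ] Op V →ₗ[ℤ] Op V :=
  LinearMap.mk₂ ℤ (wedge p q)
    (fun A B C => by funext x; simp [wedge, add_mul, Finset.sum_add_distrib])
    (fun c A B => by
      funext x
      simp only [wedge, Pi.smul_apply, Finset.smul_sum, zsmul_eq_mul]
      exact Finset.sum_congr rfl fun σ _ => by ring)
    (fun A B C => by funext x; simp [wedge, mul_add, Finset.sum_add_distrib])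
    (fun c A B => by
      funext x
      simp only [wedge, Pi.smul_apply, Finset.smul_sum, zsmul_eq_mul]
      exact Finset.sum_congr rfl fun σ _ => by ring)

theorem wedge_sub_left (p q : ℕ) (A B C : Op V) :
    wedge p q (A - B) C = wedge p q A C - wedge p q B C :=
  (wedgeHom p q).map_sub₂ A B C

theorem wedge_sum_left {ι : Type*} (s : Finset ι) (p q : ℕ) (A : ι → Op V) (B : Op V) :
    wedge p q (∑ i ∈ s, A i) B = ∑ i ∈ s, wedge p q (A i) B :=
  map_sum ((wedgeHom (V := V) p q).flip B) A s

theorem wedge_sum_right {ι : Type*} (s : Finset ι) (p q : ℕ) (A : Op V) (B : ι → Op V) :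
    wedge p q A (∑ i ∈ s, B i) = ∑ i ∈ s, wedge p q A (B i) :=
  map_sum (wedgeHom (V := V) p q A) B s

theorem wedge_zsmul_left (p q : ℕ) (c : ℤ) (A B : Op V) :
    wedge p q (c • A) B = c • wedge p q A B :=
  map_zsmul ((wedgeHom (V := V) p q).flip B) c A

theorem wedge_zsmul_right (p q : ℕ) (c : ℤ) (A B : Op V) :
    wedge p q A (c • B) = c • wedge p q A B :=
  map_zsmul (wedgeHom (V := V) p q A) c B

theorem wedgeList_cons_eq_zsmul (X : Op V) {L M : List (Op V)} {c : ℤ}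
    (hl : L.length = M.length) (h : wedgeList L = c • wedgeList M) :
    wedgeList (X :: L) = c • wedgeList (X :: M) := by
  rw [wedgeList, wedgeList, h, hl, wedge_zsmul_right]

theorem wedgeList_swap {X Y : Op V} {L : List (Op V)} (hX : DependsOn 1 X) (hY : DependsOn 1 Y)
    (hL : ∀ Z ∈ L, DependsOn 1 Z) :
    wedgeList (X :: Y :: L) = (-1 : ℤ) • wedgeList (Y :: X :: L) := by
  have hXY : ∀ Z ∈ [X, Y], DependsOn 1 Z := by simp [hX, hY]
  have hYX : ∀ Z ∈ [Y, X], DependsOn 1 Z := by simp [hX, hY]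
  have h : wedgeList [X, Y] = (-1 : ℤ) • wedgeList [Y, X] := by
    rw [wedgeList_eq_detOp hXY, wedgeList_eq_detOp hYX]
    funext x
    change Matrix.det (n := Fin 2) (R := V) _ = (-1 : ℤ) • Matrix.det (n := Fin 2) (R := V) _
    simp [Matrix.det_fin_two]
  have e (X Y : Op V) : X :: Y :: L = [X, Y] ++ L := rfl
  rw [e X Y, e Y X, ← wedge_wedgeList rfl rfl hXY hL, ← wedge_wedgeList rfl rfl hYX hL, h,
    wedge_zsmul_left]
  rfl

theorem wedgeList_append_cons {X : Op V} {L M : List (Op V)} (hX : DependsOn 1 X)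
    (hL : ∀ Z ∈ L, DependsOn 1 Z) (hM : ∀ Z ∈ M, DependsOn 1 Z) :
    wedgeList (L ++ X :: M) = (-1 : ℤ) ^ L.length • wedgeList (X :: (L ++ M)) := by
  induction L with
  | nil => simp
  | cons Y L ih =>
    have hY := hL Y List.mem_cons_self
    have hL' : ∀ Z ∈ L, DependsOn 1 Z := fun Z hZ => hL Z (List.mem_cons_of_mem _ hZ)
    have hLM : ∀ Z ∈ L ++ M, DependsOn 1 Z := fun Z hZ =>
      (List.mem_append.1 hZ).elim (hL' Z) (hM Z)
    rw [List.cons_append, wedgeList_cons_eq_zsmul Y (by simp; omega) (ih hL'),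
      wedgeList_swap hY hX hLM, smul_smul, List.length_cons, pow_succ]
    rfl

theorem wedgeList_append_comm {L M : List (Op V)}
    (hL : ∀ Z ∈ L, DependsOn 1 Z) (hM : ∀ Z ∈ M, DependsOn 1 Z) :
    wedgeList (L ++ M) = (-1 : ℤ) ^ (L.length * M.length) • wedgeList (M ++ L) := by
  induction L with
  | nil => simp
  | cons X L ih =>
    have hX := hL X List.mem_cons_self
    have hL' : ∀ Z ∈ L, DependsOn 1 Z := fun Z hZ => hL Z (List.mem_cons_of_mem _ hZ)
    rw [List.cons_append, wedgeList_cons_eq_zsmul X (by simp; omega) (ih hL'),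
      wedgeList_append_cons hX hM hL', smul_smul, List.length_cons, add_one_mul, pow_add, mul_assoc,
      ← pow_add _ M.length, Even.neg_one_pow ⟨_, rfl⟩, mul_one]

theorem wedgeList_set_append {X : Op V} {L M : List (Op V)} (hX : DependsOn 1 X)
    (hL : ∀ Z ∈ L, DependsOn 1 Z) (hM : ∀ Z ∈ M, DependsOn 1 Z) {i : ℕ} (hi : i < L.length) :
    wedgeList (L.set i X ++ M) = (-1 : ℤ) ^ i • wedgeList (X :: (L.eraseIdx i ++ M)) := by
  rw [List.set_eq_take_append_cons_drop, if_pos hi, List.eraseIdx_eq_take_drop_succ,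
    List.append_assoc, List.cons_append, wedgeList_append_cons hX, List.append_assoc,
    List.length_take_of_le hi.le]
  · exact fun Z hZ => hL Z (List.mem_of_mem_take hZ)
  · exact fun Z hZ => (List.mem_append.1 hZ).elim (fun h => hL Z (List.mem_of_mem_drop h)) (hM Z)

theorem wedgeList_consV {X : Op V} {L : List (Op V)} (hL : ∀ Z ∈ X :: L, DependsOn 1 Z)
    (v : V) (y : ℕ → V) :
    wedgeList (X :: L) (consV v y) =
      ∑ i : Fin (X :: L).length, (-1 : ℤ) ^ (i : ℕ) •
        (app1 ((X :: L).get i) v * wedgeList ((X :: L).eraseIdx i) (trunc L.length y)) := by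
  rw [wedgeList_eq_detOp hL]
  change Matrix.det (n := Fin (L.length + 1)) _ = _
  rw [Matrix.det_succ_row_zero]
  refine Finset.sum_congr rfl fun i _ => ?_
  have hlen : ((X :: L).eraseIdx i).length = L.length := by
    rw [List.length_eraseIdx_of_lt i.2]; rfl
  rw [wedgeList_eq_detOp fun Z hZ => hL Z (List.mem_of_mem_eraseIdx hZ), hlen, detOp,
    zsmul_eq_mul, mul_assoc]
  push_cast
  congr 2
  · have hi : (i : ℕ) < (X :: L).length := i.2
    rw [Matrix.of_apply, List.getD_eq_getElem _ _ hi]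
    rfl
  · congr 1
    ext j t
    have ht : (t : ℕ) < L.length := t.2
    simp only [Matrix.submatrix_apply, Matrix.of_apply, trunc, if_pos j.2, consV, Fin.val_succ,
      Nat.succ_ne_zero, if_false, Nat.add_sub_cancel, Fin.succAbove, Fin.lt_def, Fin.val_castSucc,
      List.getD_eq_getElem?_getD, List.getElem?_eraseIdx]
    split_ifs <;> rfl

section Derivation

variable {k : Type*} [CommRing k] [Algebra k V]

theorem MemADer.dependsOn {X : Op V} (hX : MemADer k 0 X) : DependsOn 1 X := hX.1.1

theorem MemADer.exists_derivation {X : Op V} (hX : MemADer k 0 X) :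
    ∃ D : Derivation k V V, ∀ v, D v = app1 X v := by
  have h₀ (x : ℕ → V) : X x = app1 X (x 0) := hX.dependsOn.app1_eq x
  obtain ⟨⟨-, hlin⟩, -, hmul⟩ := hX
  obtain ⟨hsmul, hadd⟩ := hlin 0 Nat.one_pos
  refine ⟨Derivation.mk' { toFun := app1 X, map_add' := fun v w => ?_, map_smul' := fun c v => ?_ }
    fun v w => ?_, fun v => rfl⟩
  · have := hadd 0 v w
    rw [h₀, h₀ (Function.update _ _ v), h₀ (Function.update _ _ w)] at this
    simpa using this
  · have := hsmul 0 c v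
    rw [h₀, h₀ (Function.update _ _ v)] at this
    simpa using this
  · have := hmul le_rfl v w 0
    rw [h₀, h₀ (consV w _), h₀ (consV v _)] at this
    simpa [consV] using this

theorem derivation_wedge (D : Derivation k V V) (p q : ℕ) (A B : Op V) :
    (fun x => D (wedge p q A B x)) =
      wedge p q (fun x => D (A x)) B + wedge p q A (fun x => D (B x)) := by
  funext x
  simp only [wedge, Pi.add_apply, map_sum, map_zsmul, Derivation.leibniz, smul_eq_mul,
    ← Finset.sum_add_distrib, ← smul_add]
  exact Finset.sum_congr rfl fun σ _ => by ring

theorem derivation_wedgeList (D : Derivation k V V) (L : List (Op V)) :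
    (fun x => D (wedgeList L x)) =
      ∑ i : Fin L.length, wedgeList (L.set i fun x => D (L.get i x)) := by
  induction L with
  | nil => funext x; simp [wedgeList]
  | cons X L ih =>
    simp only [wedgeList]
    rw [derivation_wedge, ih, wedge_sum_right]
    refine Eq.trans ?_ (Fin.sum_univ_succ (n := L.length) _).symm
    simp only [List.length_cons, Fin.val_zero, List.set_cons_zero, wedgeList, Fin.val_succ,
      List.set_cons_succ, List.length_set]
    rfl

theorem compOp_dependsOn {V : Type*} (X Y : Op V) : DependsOn 1 (compOp X Y) := fun x y h => by
  simp [compOp, h 0 Nat.one_pos]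

theorem nrIns_wedgeList {L M : List (Op V)} (hne : L ≠ []) (hL : ∀ X ∈ L, MemADer k 0 X)
    (hM : ∀ X ∈ M, DependsOn 1 X) :
    nrIns L.length M.length (wedgeList L) (wedgeList M) =
      ∑ i : Fin L.length, ∑ j : Fin M.length, (-1 : ℤ) ^ ((i : ℕ) + (j : ℕ)) •
        wedgeList (compOp (L.get i) (M.get j) :: (M.eraseIdx j ++ L.eraseIdx i)) := by
  have hL' : ∀ X ∈ L, DependsOn 1 X := fun X hX => (hL X hX).dependsOn
  obtain ⟨X, L, rfl⟩ := List.exists_cons_of_ne_nil hne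
  trans ∑ i : Fin (X :: L).length, (-1 : ℤ) ^ (i : ℕ) • wedge M.length L.length
    (fun x => app1 ((X :: L).get i) (wedgeList M x)) (wedgeList ((X :: L).eraseIdx i))
  · refine (nrIns_eq_unshuffleSum L.length _ _ _).trans (funext fun x => ?_)
    simp only [wedge_eq_unshuffleSum, unshuffleSum, wedgeList_consV hL', Finset.sum_apply,
      Pi.smul_apply, Finset.smul_sum]
    rw [Finset.sum_comm]
    refine Finset.sum_congr rfl fun i _ => Finset.sum_congr rfl fun σ _ => ?_
    rw [smul_comm]
    congr 4
    funext j
    simp only [trunc]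
    split_ifs <;> rfl
  · refine Finset.sum_congr rfl fun i _ => ?_
    obtain ⟨D, hD⟩ := (hL _ (List.get_mem _ i)).exists_derivation
    have hE : ∀ Z ∈ (X :: L).eraseIdx i, DependsOn 1 Z := fun Z hZ =>
      hL' Z (List.mem_of_mem_eraseIdx hZ)
    simp only [← hD]
    rw [derivation_wedgeList, wedge_sum_left, Finset.smul_sum]
    refine Finset.sum_congr rfl fun j _ => ?_
    have hc : (fun x => D (M.get j x)) = compOp ((X :: L).get i) (M.get j) := by
      funext x
      rw [hD, (hM _ (List.get_mem _ j)).app1_eq x]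
      rfl
    rw [hc, wedge_wedgeList (List.length_set ..) (by rw [List.length_eraseIdx_of_lt i.2]; rfl) _ hE,
      wedgeList_set_append (compOp_dependsOn _ _) hM hE j.2, smul_smul, pow_add]
    intro Z hZ
    rcases List.mem_or_eq_of_mem_set hZ with h | rfl
    · exact hM Z h
    · exact compOp_dependsOn _ _

end Derivation

end WedgeList

theorem commOp_eq_sub {V : Type*} [AddCommGroup V] (X Y : Op V) :
    commOp X Y = compOp X Y - compOp Y X := rfl

theorem neg_one_zpow_units_mul (m n : ℕ) :
    (((-1 : ℤˣ) ^ ((m : ℤ) * (n : ℤ)) : ℤˣ) : ℤ) = (-1) ^ (m * n) := by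
  rw [← Nat.cast_mul, zpow_natCast]
  simp

/-- for derivations `X_1,…,X_m, Y_1,…,Y_n ∈ ADer^0(V)`,
`[X_1∧…∧X_m, Y_1∧…∧Y_n]^{NR} = Σ_{k,l} (−1)^{k+l} [X_k,Y_l] ∧ X_1∧…∧X̂_k∧…∧X_m
∧ Y_1∧…∧Ŷ_l∧…∧Y_n`, where `[X_k,Y_l]` is the commutator of derivations. -/
theorem statement13 (k V : Type*) [Field k] [CharZero k]
    [CommRing V] [Algebra k V]
    (Xs Ys : List (Op V)) (hm : Xs ≠ []) (hn : Ys ≠ [])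
    (hXs : ∀ X ∈ Xs, MemADer k 0 X) (hYs : ∀ Y ∈ Ys, MemADer k 0 Y) :
    nrBracket ((Xs.length : ℤ) - 1) ((Ys.length : ℤ) - 1)
        (wedgeList Xs) (wedgeList Ys) =
      ∑ i : Fin Xs.length, ∑ j : Fin Ys.length,
        ((-1 : ℤ) ^ ((i : ℕ) + (j : ℕ))) •
          wedge 1 (Xs.length + Ys.length - 2)
            (commOp (Xs.get i) (Ys.get j))
            (wedgeList (Xs.eraseIdx (i : ℕ) ++ Ys.eraseIdx (j : ℕ))) := by
  have hX : ∀ X ∈ Xs, DependsOn 1 X := fun X h => (hXs X h).dependsOn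
  have hY : ∀ Y ∈ Ys, DependsOn 1 Y := fun Y h => (hYs Y h).dependsOn
  have har (L : List (Op V)) : ar ((L.length : ℤ) - 1) = L.length := by simp [ar]
  rw [nrBracket, har, har, nrIns_wedgeList hn hYs hX, nrIns_wedgeList hm hXs hY, Finset.sum_comm,
    Finset.smul_sum, ← Finset.sum_neg_distrib, ← Finset.sum_add_distrib]
  refine Finset.sum_congr rfl fun i _ => ?_
  rw [Finset.smul_sum, ← Finset.sum_neg_distrib, ← Finset.sum_add_distrib]
  refine Finset.sum_congr rfl fun j _ => ?_
  have hXi := List.length_eraseIdx_add_one i.2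
  have hYj := List.length_eraseIdx_add_one j.2
  have hlen : Xs.length + Ys.length - 2 = (Xs.eraseIdx i ++ Ys.eraseIdx j).length := by
    rw [List.length_append]
    omega
  have hcomm : wedgeList (Ys.eraseIdx j ++ Xs.eraseIdx i) = _ :=
    wedgeList_append_comm (fun Z hZ => hY Z (List.mem_of_mem_eraseIdx hZ))
      fun Z hZ => hX Z (List.mem_of_mem_eraseIdx hZ)
  have ha : (Xs.length : ℤ) - 1 = (Xs.eraseIdx i).length := by omega
  have hb : (Ys.length : ℤ) - 1 = (Ys.eraseIdx j).length := by omega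
  rw [wedgeList_cons_eq_zsmul _ (by simp [add_comm]) hcomm, ha, hb, neg_one_zpow_units_mul,
    smul_comm _ _ (wedgeList _), smul_smul, smul_smul, mul_comm (Ys.eraseIdx j).length, ← pow_add,
    Even.neg_one_pow ⟨_, rfl⟩, one_mul, commOp_eq_sub, wedge_sub_left, hlen, smul_sub,
    add_comm (j : ℕ), neg_add_eq_sub]
  rfl

end JacobiRevisited
end
end

section
/- Let Z ∈ ADer^0(V) be a derivation of the commutative algebra V, and let A_1 ∈ ADer^a(V), A_2 ∈ ADer^{a−1}(V), B_1 ∈ ADer^b(V), B_2 ∈ ADer^{b−1}(V) be Z-homogeneous multiderivations, i.e. [Z,A_1]^{NR} = −a·A_1, [Z,A_2]^{NR} = −a·A_2, [Z,B_1]^{NR} = −b·B_1, [Z,B_2]^{NR} = −b·B_2. Then [A_1 + Z∧A_2, B_1 + Z∧B_2]^{NR} = [A_1,B_1]^{NR} + a·A_1∧B_2 − (−1)^a b·A_2∧B_1 + (−1)^a Z∧[A_1,B_2]^{NR} + Z∧[A_2,B_1]^{NR} + (a−b)·Z∧A_2∧B_2. Consequently, the map H_Z(A_1 + I∧A_2)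 = A_1 + Z∧A_2 is a homomorphism from the Nijenhuis–Richardson bracket on Z-homogeneous first-order operators into the Nijenhuis–Richardson bracket on multiderivations. -/
/-!  Common framework: operations of degree `a ≥ -1` on a vector space `V`
(i.e. `(a+1)`-linear maps `V^{a+1} → V`) are encoded as raw functions
`(ℕ → V) → V` depending only on the first `a+1` entries of the argument
sequence, together with explicit multilinearity/alternation predicates. -/

noncomputable section
open scoped Classical

namespace JacobiRevisited

/-! ### Graded functions on lists

A function `F : List V → X` encodes one operation of every arity; its contraction with `v` is
`ctr v F`.  Wedge product and insertion become instances of one recursively defined shuffle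
product. -/

section ShuffleAlgebra

/-- Contraction with `v` in the first slot. -/
def ctr {V X : Type*} (v : V) (F : List V → X) : List V → X := fun l => F (v :: l)

/-- The parity involution. -/
def eps {V X : Type*} [AddCommGroup X] (F : List V → X) : List V → X :=
  fun l => (((-1 : ℤˣ) ^ l.length : ℤˣ) : ℤ) • F l

/-- The signed shuffle product along a pairing `m`. -/
def shuf {V X Y W : Type*} [AddCommGroup X] [AddCommGroup W] (m : X → Y → W) :
    (List V → X) → (List V → Y) → List V → W
  | F, G, [] => m (F []) (G [])
  | F, G, v :: l => shuf m (ctr v F) G l + shuf m (eps F) (ctr v G) l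

/-- The wedge product of functions on lists. -/
def wdg {V : Type*} [CommRing V] (F G : List V → V) : List V → V := shuf (· * ·) F G

/-- The insertion of `B` into the first slot of `A`. -/
def ins {V : Type*} [AddCommGroup V] (B A : List V → V) : List V → V :=
  shuf (fun u g => g u) B fun l u => A (u :: l)

/-- Skew-symmetry under adjacent transpositions. -/
def Skew {V : Type*} [AddCommGroup V] (F : List V → V) : Prop :=
  ∀ l₁ u v l₂, F (l₁ ++ u :: v :: l₂) = -F (l₁ ++ v :: u :: l₂)

/-- Additivity in every slot. -/
def Additive {V : Type*} [AddCommGroup V] (F : List V → V) : Prop :=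
  ∀ l₁ u v l₂, F (l₁ ++ (u + v) :: l₂) = F (l₁ ++ u :: l₂) + F (l₁ ++ v :: l₂)

/-- The Leibniz rule in the first slot. -/
def Leibniz {V : Type*} [CommRing V] (F : List V → V) : Prop :=
  ∀ u v l, F ((u * v) :: l) = u * F (v :: l) + v * F (u :: l)

/-- `F` is supported on lists of length `d`. -/
def HasArity {V X : Type*} [Zero X] (d : ℤ) (F : List V → X) : Prop :=
  ∀ l, (l.length : ℤ) ≠ d → F l = 0

/-- `F` has a definite arity of sign `s`. -/
def HasSign {V X : Type*} [Zero X] (s : ℤˣ) (F : List V → X) : Prop :=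
  ∃ d : ℤ, (-1 : ℤˣ) ^ d = s ∧ HasArity d F

/-- The Koszul sign of interchanging elements of signs `s` and `t`. -/
def koszul (s t : ℤˣ) : ℤ := if s = -1 ∧ t = -1 then -1 else 1

section Group
variable {V X : Type*} [AddCommGroup X]

theorem ctr_add (v : V) (F G : List V → X) : ctr v (F + G) = ctr v F + ctr v G := rfl

theorem ctr_zsmul (v : V) (c : ℤ) (F : List V → X) : ctr v (c • F) = c • ctr v F := rfl

theorem eps_nil (F : List V → X) : eps F [] = F [] := by simp [eps]

theorem ctr_eps (v : V) (F : List V → X) : ctr v (eps F) = (-1 : ℤ) • eps (ctr v F) := by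
  funext l
  simp [ctr, eps, pow_succ]

theorem eps_add (F G : List V → X) : eps (F + G) = eps F + eps G := by
  funext l
  simp [eps]

theorem eps_zsmul (c : ℤ) (F : List V → X) : eps (c • F) = c • eps F := by
  funext l
  simp only [eps, Pi.smul_apply]
  rw [smul_comm]

theorem HasArity.ctr {d : ℤ} {F : List V → X} (h : HasArity d F) (v : V) :
    HasArity (d - 1) (ctr v F) := by
  intro l hl
  apply h
  simp only [List.length_cons, Nat.cast_add, Nat.cast_one]
  omega

theorem HasArity.eps {d : ℤ} {F : List V → X} (h : HasArity d F) : HasArity d (eps F) := by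
  intro l hl
  simp [JacobiRevisited.eps, h l hl]

theorem HasSign.ctr {s : ℤˣ} {F : List V → X} (h : HasSign s F) (v : V) :
    HasSign (-s) (ctr v F) := by
  obtain ⟨d, rfl, h⟩ := h
  refine ⟨d - 1, ?_, h.ctr v⟩
  rw [zpow_sub_one]
  simp

theorem HasSign.eps_eq {s : ℤˣ} {F : List V → X} (h : HasSign s F) :
    eps F = (s : ℤ) • F := by
  obtain ⟨d, rfl, h⟩ := h
  funext l
  by_cases hl : (l.length : ℤ) = d
  · subst hl
    simp [eps]
  · simp [eps, h l hl]

theorem HasSign.nil {F : List V → X} (h : HasSign (-1) F) : F [] = 0 := by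
  obtain ⟨d, hd, h⟩ := h
  apply h
  rintro rfl
  simp at hd

variable [AddCommGroup V]

theorem Skew.ctr {F : List V → V} (h : Skew F) (v : V) : Skew (ctr v F) :=
  fun l₁ => h (v :: l₁)

theorem Additive.add {F G : List V → V} (hF : Additive F) (hG : Additive G) :
    Additive (F + G) := by
  intro l₁ u v l₂
  simp only [Pi.add_apply, hF l₁ u v l₂, hG l₁ u v l₂]
  abel

theorem Additive.ctr {F : List V → V} (h : Additive F) (v : V) : Additive (ctr v F) :=
  fun l₁ => h (v :: l₁)

theorem Skew.eps {F : List V → V} (h : Skew F) : Skew (eps F) := by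
  intro l₁ u v l₂
  simp [JacobiRevisited.eps, h l₁ u v l₂]

theorem Additive.eps {F : List V → V} (h : Additive F) : Additive (eps F) := by
  intro l₁ u v l₂
  simp [JacobiRevisited.eps, h l₁ u v l₂]

theorem Additive.ctr_zero {F : List V → V} (h : Additive F) : JacobiRevisited.ctr 0 F = 0 := by
  funext l
  have := h [] 0 0 l
  simpa [JacobiRevisited.ctr] using this

theorem Additive.ctr_add_vec {F : List V → V} (h : Additive F) (u v : V) :
    JacobiRevisited.ctr (u + v) F = JacobiRevisited.ctr u F + JacobiRevisited.ctr v F :=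
  funext fun l => h [] u v l

theorem Additive.cons_zsmul {F : List V → V} (h : Additive F) (c : ℤ) (u : V) (l : List V) :
    F ((c • u) :: l) = c • F (u :: l) :=
  map_zsmul (AddMonoidHom.mk' (fun u => F (u :: l)) fun u v => h [] u v l) c u

theorem ins_nil (B A : List V → V) : ins B A [] = A [B []] := rfl

theorem ins_add_right (B A A' : List V → V) : ins B (A + A') = ins B A + ins B A' := by
  funext l
  induction l generalizing B A A' with
  | nil => rfl
  | cons v l ih =>
    change ins (ctr v B) (A + A') l + ins (eps B) ((fun l => A (l.headD 0 :: v :: l.tail)) +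
      fun l => A' (l.headD 0 :: v :: l.tail)) l = _
    rw [ih, ih]
    change _ = (ins (ctr v B) A l + ins (eps B) (fun l => A (l.headD 0 :: v :: l.tail)) l) +
      (ins (ctr v B) A' l + ins (eps B) (fun l => A' (l.headD 0 :: v :: l.tail)) l)
    simp only [Pi.add_apply]
    abel

theorem ins_zsmul_right (c : ℤ) (B A : List V → V) : ins B (c • A) = c • ins B A := by
  funext l
  induction l generalizing B A with
  | nil => rfl
  | cons v l ih =>
    change ins (ctr v B) (c • A) l + ins (eps B) (c • fun l => A (l.headD 0 :: v :: l.tail)) l = _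
    rw [ih, ih]
    exact (smul_add c _ _).symm

theorem ctr_ins {A : List V → V} (hA : Skew A) (v : V) (B : List V → V) :
    ctr v (ins B A) = ins (ctr v B) A + (-1 : ℤ) • ins (eps B) (ctr v A) := by
  have h : (fun (l : List V) (u : V) => A (u :: v :: l)) =
      fun l u => ((-1 : ℤ) • ctr v A) (u :: l) := by
    funext l u
    simpa [ctr] using hA [] u v l
  funext l
  change ins (ctr v B) A l + shuf (fun u g => g u) (eps B) (fun l u => A (u :: v :: l)) l = _
  rw [h]
  change ins (ctr v B) A l + ins (eps B) ((-1 : ℤ) • ctr v A) l = _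
  rw [ins_zsmul_right]
  rfl

theorem ins_add_left {A : List V → V} (hA : Skew A) (hA' : Additive A) (B B' : List V → V) :
    ins (B + B') A = ins B A + ins B' A := by
  funext l
  induction l generalizing B B' A with
  | nil => exact hA' [] _ _ _
  | cons v l ih =>
    change ctr v (ins (B + B') A) l = ctr v (ins B A) l + ctr v (ins B' A) l
    simp only [ctr_ins hA, ctr_add, eps_add, Pi.add_apply, Pi.smul_apply]
    rw [ih hA hA', ih (hA.ctr v) (hA'.ctr v)]
    simp only [Pi.add_apply]
    module

theorem ins_zsmul_left {A : List V → V} (hA : Skew A) (hA' : Additive A) (c : ℤ)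
    (B : List V → V) : ins (c • B) A = c • ins B A := by
  funext l
  induction l generalizing B A with
  | nil => exact hA'.cons_zsmul c _ _
  | cons v l ih =>
    change ctr v (ins (c • B) A) l = c • ctr v (ins B A) l
    simp only [ctr_ins hA, ctr_zsmul, eps_zsmul, Pi.add_apply, Pi.smul_apply]
    rw [ih hA hA', ih (hA.ctr v) (hA'.ctr v)]
    simp only [Pi.smul_apply]
    module

theorem HasArity.ins {d e : ℤ} {A B : List V → V} (hB : HasArity d B) (hA : HasArity e A)
    (hs : Skew A) (ha : Additive A) : HasArity (d + e - 1) (ins B A) := by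
  intro l hl
  induction l generalizing A B d e with
  | nil =>
    rw [ins_nil]
    by_cases hd : d = 0
    · exact hA _ (by simp at hl ⊢; omega)
    · rw [hB [] (by simp; omega)]
      exact congrFun ha.ctr_zero []
  | cons v l ih =>
    simp only [List.length_cons, Nat.cast_add, Nat.cast_one] at hl
    change JacobiRevisited.ctr v (JacobiRevisited.ins B A) l = 0
    rw [ctr_ins hs, Pi.add_apply, Pi.smul_apply, ih (hB.ctr v) hA hs ha (by omega),
      ih hB.eps (hA.ctr v) (hs.ctr v) (ha.ctr v) (by omega), smul_zero, add_zero]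

theorem HasSign.ins {s t : ℤˣ} {A B : List V → V} (hB : HasSign t B) (hA : HasSign s A)
    (hs : Skew A) (ha : Additive A) : HasSign (-(t * s)) (ins B A) := by
  obtain ⟨d, rfl, hB⟩ := hB
  obtain ⟨e, rfl, hA⟩ := hA
  refine ⟨_, ?_, hB.ins hA hs ha⟩
  rw [zpow_sub_one, zpow_add]
  simp

end Group

section Ring
variable {V : Type*} [CommRing V]

theorem wdg_nil (F G : List V → V) : wdg F G [] = F [] * G [] := rfl

theorem ctr_wdg (v : V) (F G : List V → V) :
    ctr v (wdg F G) = wdg (ctr v F) G + wdg (eps F) (ctr v G) := rfl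

theorem wdg_add_left (F F' G : List V → V) : wdg (F + F') G = wdg F G + wdg F' G := by
  funext l
  induction l generalizing F F' G with
  | nil => exact add_mul _ _ _
  | cons v l ih =>
    change ctr v (wdg (F + F') G) l = ctr v (wdg F G) l + ctr v (wdg F' G) l
    simp only [ctr_wdg, ctr_add, eps_add, Pi.add_apply, ih]
    abel

theorem wdg_add_right (F G G' : List V → V) : wdg F (G + G') = wdg F G + wdg F G' := by
  funext l
  induction l generalizing F G G' with
  | nil => exact mul_add _ _ _
  | cons v l ih =>
    change ctr v (wdg F (G + G')) l = ctr v (wdg F G) l + ctr v (wdg F G') l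
    simp only [ctr_wdg, ctr_add, Pi.add_apply, ih]
    abel

theorem wdg_zsmul_left (c : ℤ) (F G : List V → V) : wdg (c • F) G = c • wdg F G := by
  funext l
  induction l generalizing F G with
  | nil => exact smul_mul_assoc c (F []) (G [])
  | cons v l ih =>
    change ctr v (wdg (c • F) G) l = c • ctr v (wdg F G) l
    simp only [ctr_wdg, ctr_zsmul, eps_zsmul, Pi.add_apply, Pi.smul_apply, ih, smul_add]

theorem wdg_zsmul_right (c : ℤ) (F G : List V → V) : wdg F (c • G) = c • wdg F G := by
  funext l
  induction l generalizing F G with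
  | nil => exact mul_smul_comm c (F []) (G [])
  | cons v l ih =>
    change ctr v (wdg F (c • G)) l = c • ctr v (wdg F G) l
    simp only [ctr_wdg, ctr_zsmul, Pi.add_apply, Pi.smul_apply, ih, smul_add]

theorem wdg_zero_left (G : List V → V) : wdg 0 G = 0 := by
  simpa using wdg_zsmul_left 0 0 G

theorem Additive.wdg {F G : List V → V} (hF : Additive F) (hG : Additive G) :
    Additive (wdg F G) := by
  intro l₁ u v l₂
  induction l₁ generalizing F G with
  | nil =>
    change JacobiRevisited.ctr (u + v) (JacobiRevisited.wdg F G) l₂ =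
      JacobiRevisited.ctr u (JacobiRevisited.wdg F G) l₂ +
      JacobiRevisited.ctr v (JacobiRevisited.wdg F G) l₂
    simp only [ctr_wdg, hF.ctr_add_vec, hG.ctr_add_vec, wdg_add_left, wdg_add_right, Pi.add_apply]
    abel
  | cons w l₁ ih =>
    have h (l : List V) : JacobiRevisited.wdg F G (w :: l) =
      JacobiRevisited.wdg (JacobiRevisited.ctr w F) G l +
      JacobiRevisited.wdg (JacobiRevisited.eps F) (JacobiRevisited.ctr w G) l := rfl
    simp only [List.cons_append, h, ih (hF.ctr w) hG, ih hF.eps (hG.ctr w)]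
    abel

theorem Skew.ctr_ctr {F : List V → V} (hF : Skew F) (u v : V) :
    JacobiRevisited.ctr u (JacobiRevisited.ctr v F) =
      (-1 : ℤ) • JacobiRevisited.ctr v (JacobiRevisited.ctr u F) := by
  funext l
  simpa [JacobiRevisited.ctr] using hF [] v u l

theorem Skew.wdg {F G : List V → V} (hF : Skew F) (hG : Skew G) : Skew (wdg F G) := by
  intro l₁ u v l₂
  induction l₁ generalizing F G with
  | nil =>
    change JacobiRevisited.ctr v (JacobiRevisited.ctr u (JacobiRevisited.wdg F G)) l₂ =
      -JacobiRevisited.ctr u (JacobiRevisited.ctr v (JacobiRevisited.wdg F G)) l₂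
    simp only [ctr_wdg, ctr_add, ctr_eps, wdg_zsmul_left, wdg_zsmul_right, hF.ctr_ctr v u,
      hG.ctr_ctr v u, Pi.add_apply, Pi.smul_apply]
    module
  | cons w l₁ ih =>
    have h (l : List V) : JacobiRevisited.wdg F G (w :: l) =
      JacobiRevisited.wdg (JacobiRevisited.ctr w F) G l +
      JacobiRevisited.wdg (JacobiRevisited.eps F) (JacobiRevisited.ctr w G) l := rfl
    simp only [List.cons_append, h]
    rw [ih (hF.ctr w) hG, ih hF.eps (hG.ctr w)]
    abel

theorem Leibniz.ctr {F : List V → V} (hF : Leibniz F) (hs : Skew F) (w : V) :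
    Leibniz (ctr w F) := by
  intro u v l
  have h (u : V) : F (w :: u :: l) = -F (u :: w :: l) := hs [] w u l
  simp only [JacobiRevisited.ctr, h, hF u v (w :: l)]
  ring

theorem HasArity.wdg {d e : ℤ} {F G : List V → V} (hF : HasArity d F) (hG : HasArity e G) :
    HasArity (d + e) (wdg F G) := by
  intro l hl
  induction l generalizing F G d e with
  | nil =>
    rw [wdg_nil]
    by_cases hd : d = 0
    · rw [hG [] (by simp at hl ⊢; omega), mul_zero]
    · rw [hF [] (by simp; omega), zero_mul]
  | cons v l ih =>
    simp only [List.length_cons, Nat.cast_add, Nat.cast_one] at hl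
    change JacobiRevisited.ctr v (JacobiRevisited.wdg F G) l = 0
    rw [ctr_wdg, Pi.add_apply, ih (hF.ctr v) hG (by omega), ih hF.eps (hG.ctr v) (by omega),
      add_zero]

theorem HasSign.wdg {s t : ℤˣ} {F G : List V → V} (hF : HasSign s F) (hG : HasSign t G) :
    HasSign (s * t) (wdg F G) := by
  obtain ⟨d, rfl, hF⟩ := hF
  obtain ⟨e, rfl, hG⟩ := hG
  exact ⟨_, zpow_add _ _ _, hF.wdg hG⟩

theorem eps_wdg (F G : List V → V) : eps (wdg F G) = wdg (eps F) (eps G) := by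
  funext l
  induction l generalizing F G with
  | nil => simp [eps_nil, wdg_nil]
  | cons v l ih =>
    change ctr v (eps (wdg F G)) l = ctr v (wdg (eps F) (eps G)) l
    simp only [ctr_eps, ctr_wdg, eps_add, wdg_zsmul_left, wdg_zsmul_right, Pi.add_apply,
      Pi.smul_apply, ih, smul_add]

theorem wdg_assoc (F G H : List V → V) : wdg (wdg F G) H = wdg F (wdg G H) := by
  funext l
  induction l generalizing F G H with
  | nil => exact mul_assoc _ _ _
  | cons v l ih =>
    change ctr v (wdg (wdg F G) H) l = ctr v (wdg F (wdg G H)) l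
    simp only [ctr_wdg, eps_wdg, wdg_add_left, wdg_add_right, Pi.add_apply, ih]
    abel

theorem wdg_comm {s t : ℤˣ} {F G : List V → V} (hF : HasSign s F) (hG : HasSign t G) :
    wdg F G = koszul s t • wdg G F := by
  funext l
  induction l generalizing F G s t with
  | nil =>
    simp only [Pi.smul_apply, wdg_nil]
    rcases Int.units_eq_one_or s with rfl | rfl
    · simp [koszul, mul_comm]
    · simp [hF.nil]
  | cons v l ih =>
    change ctr v (wdg F G) l = koszul s t • ctr v (wdg G F) l
    simp only [ctr_wdg, hF.eps_eq, hG.eps_eq, wdg_zsmul_left, Pi.add_apply, Pi.smul_apply]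
    rw [ih (hF.ctr v) hG, ih hF (hG.ctr v)]
    rcases Int.units_eq_one_or s with rfl | rfl <;> rcases Int.units_eq_one_or t with rfl | rfl <;>
      simp [koszul] <;> abel

/-- Insertion is a graded derivation of the wedge product. -/
theorem ins_wdg {s t : ℤˣ} {A B C : List V → V} (hA : HasSign s A) (hB : HasSign t B)
    (hAs : Skew A) (hAa : Additive A) (hCs : Skew C) (hCa : Additive C) :
    ins B (wdg A C) = wdg (ins B A) C + koszul s (-t) • wdg A (ins B C) := by
  funext l
  induction l generalizing A B C s t with
  | nil =>
    change wdg (ctr (B []) A) C [] + wdg (eps A) (ctr (B []) C) [] =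
      A [B []] * C [] + koszul s (-t) • (A [] * C [B []])
    simp only [wdg_nil, eps_nil]
    change A [B []] * C [] + A [] * C [B []] = _
    rcases Int.units_eq_one_or s with rfl | rfl
    · simp [koszul]
    · simp [hA.nil]
  | cons v l ih =>
    change ctr v (ins B (wdg A C)) l =
      ctr v (wdg (ins B A) C + koszul s (-t) • wdg A (ins B C)) l
    have hW := hAs.wdg hCs
    simp only [ctr_ins hW, ctr_add, ctr_zsmul, ctr_wdg, hA.eps_eq, hB.eps_eq,
      (hB.ins hA hAs hAa).eps_eq, ins_add_right, ins_zsmul_right, wdg_zsmul_left, ctr_ins hAs,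
      ctr_ins hCs, wdg_add_left, wdg_add_right, wdg_zsmul_right,
      ins_zsmul_left (hAs.ctr v) (hAa.ctr v), ins_zsmul_left (hCs.ctr v) (hCa.ctr v),
      ins_zsmul_left ((hAs.ctr v).wdg hCs) ((hAa.ctr v).wdg hCa),
      ins_zsmul_left (hAs.wdg (hCs.ctr v)) (hAa.wdg (hCa.ctr v)), Pi.add_apply, Pi.smul_apply]
    rw [ih hA (hB.ctr v) hAs hAa hCs hCa, ih (hA.ctr v) hB (hAs.ctr v) (hAa.ctr v) hCs hCa,
      ih hA hB hAs hAa (hCs.ctr v) (hCa.ctr v)]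
    simp only [Pi.add_apply, Pi.smul_apply]
    rcases Int.units_eq_one_or s with rfl | rfl <;> rcases Int.units_eq_one_or t with rfl | rfl <;>
      simp [koszul] <;> abel

/-- Inserting a wedge product into a multiderivation. -/
theorem wdg_ins {s t : ℤˣ} {A B C : List V → V} (hA : HasSign s A) (hC : HasSign t C)
    (hBs : Skew B) (hBa : Additive B) (hB : Leibniz B) :
    ins (wdg A C) B = wdg A (ins C B) + koszul s t • wdg C (ins A B) := by
  funext l
  induction l generalizing A B C s t with
  | nil =>
    change B [A [] * C []] = A [] * B [C []] + koszul s t • (C [] * B [A []])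
    rw [hB]
    rcases Int.units_eq_one_or s with rfl | rfl
    · simp [koszul]
    · rcases Int.units_eq_one_or t with rfl | rfl
      · simp [koszul]
      · simp [hC.nil, hA.nil]
  | cons v l ih =>
    change ctr v (ins (wdg A C) B) l =
      ctr v (wdg A (ins C B) + koszul s t • wdg C (ins A B)) l
    simp only [ctr_ins hBs, ctr_add, ctr_zsmul, ctr_wdg, hA.eps_eq, hC.eps_eq, eps_wdg,
      wdg_zsmul_left, wdg_zsmul_right, ins_add_left hBs hBa, ins_zsmul_left hBs hBa,
      ins_zsmul_left (hBs.ctr v) (hBa.ctr v), wdg_add_right,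
      Pi.add_apply, Pi.smul_apply]
    rw [ih (hA.ctr v) hC hBs hBa hB, ih hA (hC.ctr v) hBs hBa hB,
      ih hA hC (hBs.ctr v) (hBa.ctr v) (hB.ctr hBs v)]
    simp only [Pi.add_apply, Pi.smul_apply]
    rcases Int.units_eq_one_or s with rfl | rfl <;> rcases Int.units_eq_one_or t with rfl | rfl <;>
      simp [koszul] <;> abel

theorem wdg_self {Z : List V → V} (hV : ∀ v : V, v + v = 0 → v = 0) (hZ : HasSign (-1) Z) :
    wdg Z Z = 0 := by
  funext l
  apply hV
  nth_rewrite 1 [wdg_comm hZ hZ]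
  simp [koszul]

/-- Skew-symmetric additive functions satisfying the Leibniz rule. -/
structure IsMultiderivation (F : List V → V) : Prop where
  skew : Skew F
  additive : Additive F
  leibniz : Leibniz F

/-- The mixed term `[A, Z ∧ B]` of the bracket. -/
theorem bracket_wdg_right {s t : ℤˣ} {a : ℤ} {Z A B : List V → V}
    (hZ : IsMultiderivation Z) (hA : IsMultiderivation A) (hB : IsMultiderivation B)
    (sZ : HasSign (-1) Z) (sA : HasSign (-s) A) (sB : HasSign t B)
    (h : -ins Z A + ins A Z = (-a) • A) :
    -ins A (wdg Z B) + koszul s t • ins (wdg Z B) A =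
      a • wdg A B + (s : ℤ) • wdg Z (-ins A B + koszul s (-t) • ins B A) := by
  have h' : ins Z A = ins A Z + a • A := by
    rw [neg_smul] at h
    rw [← sub_eq_zero, ← neg_eq_zero, ← sub_eq_zero.mpr h]
    abel
  rw [ins_wdg sZ sA hZ.skew hZ.additive hB.skew hB.additive,
    wdg_ins sZ sB hA.skew hA.additive hA.leibniz, h',
    wdg_add_right B, wdg_zsmul_right a B, wdg_comm sB (sA.ins sZ hZ.skew hZ.additive),
    wdg_comm sB sA, wdg_add_right Z, wdg_zsmul_right, ← neg_one_zsmul (ins A B), wdg_zsmul_right]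
  rcases Int.units_eq_one_or s with rfl | rfl <;> rcases Int.units_eq_one_or t with rfl | rfl <;>
    simp [koszul] <;> abel

/-- The quadratic term `[Z ∧ A, Z ∧ B]` of the bracket. -/
theorem bracket_wdg_wdg {s t : ℤˣ} {a b : ℤ} {Z A B : List V → V}
    (hV : ∀ v : V, v + v = 0 → v = 0)
    (hZ : IsMultiderivation Z) (hA : IsMultiderivation A) (hB : IsMultiderivation B)
    (sZ : HasSign (-1) Z) (sA : HasSign s A) (sB : HasSign t B)
    (hZA : -ins Z A + ins A Z = (-a) • A) (hZB : -ins Z B + ins B Z = (-b) • B) :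
    -ins (wdg Z A) (wdg Z B) + koszul s t • ins (wdg Z B) (wdg Z A) =
      (a - b) • wdg Z (wdg A B) := by
  have hA' : ins Z A = ins A Z + a • A := by
    rw [neg_smul] at hZA
    rw [← sub_eq_zero, ← neg_eq_zero, ← sub_eq_zero.mpr hZA]
    abel
  have hB' : ins Z B = ins B Z + b • B := by
    rw [neg_smul] at hZB
    rw [← sub_eq_zero, ← neg_eq_zero, ← sub_eq_zero.mpr hZB]
    abel
  have key {s t : ℤˣ} {b : ℤ} {A B : List V → V} (hA : IsMultiderivation A)
      (hB : IsMultiderivation B) (sA : HasSign s A) (sB : HasSign t B)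
      (hB' : ins Z B = ins B Z + b • B) :
      ins (wdg Z A) (wdg Z B) = wdg Z (wdg (ins A Z) B) + wdg (ins Z Z) (wdg A B) +
        wdg Z (wdg A (ins B Z)) + b • wdg Z (wdg A B) := by
    have hZZ : wdg Z (wdg Z (ins A B)) = 0 := by
      rw [← wdg_assoc, wdg_self hV sZ, wdg_zero_left]
    have hAZ : wdg A Z = (s : ℤ) • wdg Z A := by
      rw [wdg_comm sA sZ]
      rcases Int.units_eq_one_or s with rfl | rfl <;> simp [koszul]
    rw [ins_wdg sZ (sZ.wdg sA) hZ.skew hZ.additive hB.skew hB.additive,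
      wdg_ins sZ sA hZ.skew hZ.additive hZ.leibniz, wdg_ins sZ sA hB.skew hB.additive hB.leibniz,
      hB', wdg_add_right Z, hZZ, wdg_zsmul_right _ Z, wdg_add_right A, wdg_zsmul_right b A,
      wdg_comm sA (sZ.ins sZ hZ.skew hZ.additive), wdg_add_left, wdg_add_right Z,
      wdg_zsmul_right b Z]
    simp only [wdg_zsmul_left, wdg_assoc]
    rcases Int.units_eq_one_or s with rfl | rfl <;> simp [koszul] <;> abel
  rw [key hA hB sA sB hB', key hB hA sB sA hA', wdg_comm sB sA,
    wdg_comm (sB.ins sZ hZ.skew hZ.additive) sA, wdg_comm sB (sA.ins sZ hZ.skew hZ.additive)]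
  simp only [wdg_zsmul_right]
  rcases Int.units_eq_one_or s with rfl | rfl <;> rcases Int.units_eq_one_or t with rfl | rfl <;>
    simp [koszul] <;> ring

/-- The bracket of `A₁ + Z ∧ A₂` and `B₁ + Z ∧ B₂` for homogeneous multiderivations. -/
theorem bracket_add_wdg {s t : ℤˣ} {a b : ℤ} {Z A₁ A₂ B₁ B₂ : List V → V}
    (hV : ∀ v : V, v + v = 0 → v = 0) (hZ : IsMultiderivation Z)
    (hA₁ : IsMultiderivation A₁) (hA₂ : IsMultiderivation A₂)
    (hB₁ : IsMultiderivation B₁) (hB₂ : IsMultiderivation B₂)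
    (sZ : HasSign (-1) Z) (sA₁ : HasSign (-s) A₁) (sA₂ : HasSign s A₂)
    (sB₁ : HasSign (-t) B₁) (sB₂ : HasSign t B₂)
    (hZA₁ : -ins Z A₁ + ins A₁ Z = (-a) • A₁) (hZA₂ : -ins Z A₂ + ins A₂ Z = (-a) • A₂)
    (hZB₁ : -ins Z B₁ + ins B₁ Z = (-b) • B₁) (hZB₂ : -ins Z B₂ + ins B₂ Z = (-b) • B₂) :
    -ins (A₁ + wdg Z A₂) (B₁ + wdg Z B₂) +
        koszul s t • ins (B₁ + wdg Z B₂) (A₁ + wdg Z A₂) =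
      (-ins A₁ B₁ + koszul s t • ins B₁ A₁) + a • wdg A₁ B₂ - ((s : ℤ) * b) • wdg A₂ B₁ +
        (s : ℤ) • wdg Z (-ins A₁ B₂ + koszul s (-t) • ins B₂ A₁) +
        wdg Z (-ins A₂ B₁ + koszul (-s) t • ins B₁ A₂) + (a - b) • wdg Z (wdg A₂ B₂) := by
  have h₁ := bracket_wdg_right hZ hA₁ hB₂ sZ sA₁ sB₂ hZA₁
  have h₂ := bracket_wdg_right hZ hB₁ hA₂ sZ sB₁ sA₂ hZB₁
  have h₃ := bracket_wdg_wdg hV hZ hA₂ hB₂ sZ sA₂ sB₂ hZA₂ hZB₂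
  have h₂' : -ins (wdg Z A₂) B₁ + koszul s t • ins B₁ (wdg Z A₂) =
      -((s : ℤ) * b) • wdg A₂ B₁ + wdg Z (-ins A₂ B₁ + koszul (-s) t • ins B₁ A₂) := by
    have : -ins (wdg Z A₂) B₁ + koszul s t • ins B₁ (wdg Z A₂) =
        -koszul s t • (-ins B₁ (wdg Z A₂) + koszul t s • ins (wdg Z A₂) B₁) := by
      rcases Int.units_eq_one_or s with rfl | rfl <;>
        rcases Int.units_eq_one_or t with rfl | rfl <;> simp [koszul] <;> abel
    rw [this, h₂, wdg_comm sB₁ sA₂]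
    simp only [← neg_one_zsmul (ins _ _), wdg_add_right, wdg_zsmul_right]
    rcases Int.units_eq_one_or s with rfl | rfl <;>
      rcases Int.units_eq_one_or t with rfl | rfl <;> simp [koszul] <;> module
  rw [ins_add_right, ins_add_right, ins_add_left hB₁.skew hB₁.additive,
    ins_add_left (hZ.skew.wdg hB₂.skew) (hZ.additive.wdg hB₂.additive),
    ins_add_left hA₁.skew hA₁.additive,
    ins_add_left (hZ.skew.wdg hA₂.skew) (hZ.additive.wdg hA₂.additive)]
  linear_combination (exp := 1) h₁ + h₂' + h₃

end Ring

end ShuffleAlgebra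

/-! ### Unshuffle sums as shuffle products -/

section Unshuffle

open Equiv

theorem decomposeFin_symm_zero_succ {n : ℕ} (τ : Perm (Fin n)) (i : Fin n) :
    Perm.decomposeFin.symm (0, τ) i.succ = (τ i).succ := by
  simp

theorem decomposeFin_symm_zero_sign {n : ℕ} (τ : Perm (Fin n)) :
    Perm.sign (Perm.decomposeFin.symm (0, τ)) = Perm.sign τ := by
  simp

theorem exists_decomposeFin_of_apply_zero {n : ℕ} {σ : Perm (Fin (n + 1))} (h : σ 0 = 0) :
    ∃ τ, Perm.decomposeFin.symm (0, τ) = σ := by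
  refine ⟨(Perm.decomposeFin σ).2, ?_⟩
  have h' : (Perm.decomposeFin σ).1 = 0 := by
    have := Perm.decomposeFin_symm_apply_zero (Perm.decomposeFin σ).1 (Perm.decomposeFin σ).2
    rw [← this]
    simpa using h
  rw [← h']
  simp

theorem mem_unshuffles_s16 {n p : ℕ} {σ : Perm (Fin n)} :
    σ ∈ Unshuffles n p ↔
      (∀ i j : Fin n, (i : ℕ) < (j : ℕ) → (j : ℕ) < p → σ i < σ j) ∧
        (∀ i j : Fin n, (i : ℕ) < (j : ℕ) → p ≤ (i : ℕ) → σ i < σ j) := by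
  simp [Unshuffles]

theorem decomposeFin_symm_mem_unshuffles {n p : ℕ} (τ : Perm (Fin n)) :
    Perm.decomposeFin.symm (0, τ) ∈ Unshuffles (n + 1) (p + 1) ↔ τ ∈ Unshuffles n p := by
  rw [mem_unshuffles_s16, mem_unshuffles_s16]
  constructor
  · rintro ⟨h₁, h₂⟩
    constructor
    · intro i j hij hj
      have := h₁ i.succ j.succ (by simpa using hij) (by simpa using hj)
      rwa [decomposeFin_symm_zero_succ, decomposeFin_symm_zero_succ, Fin.succ_lt_succ_iff] at this
    · intro i j hij hj
      have := h₂ i.succ j.succ (by simpa using hij) (by simpa using hj)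
      rwa [decomposeFin_symm_zero_succ, decomposeFin_symm_zero_succ, Fin.succ_lt_succ_iff] at this
  · rintro ⟨h₁, h₂⟩
    constructor
    · intro i j hij hj
      cases j using Fin.cases with
      | zero => simp at hij
      | succ j =>
        rw [decomposeFin_symm_zero_succ]
        cases i using Fin.cases with
        | zero => simp
        | succ i =>
          rw [decomposeFin_symm_zero_succ, Fin.succ_lt_succ_iff]
          exact h₁ i j (by simpa using hij) (by simpa using hj)
    · intro i j hij hj
      cases j using Fin.cases with
      | zero => simp at hij
      | succ j =>
        rw [decomposeFin_symm_zero_succ]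
        cases i using Fin.cases with
        | zero => simp
        | succ i =>
          rw [decomposeFin_symm_zero_succ, Fin.succ_lt_succ_iff]
          exact h₂ i j (by simpa using hij) (by simpa using hj)

/-- The permutation sending `p` to `0` and acting as `τ` on the other points. -/
def insertZero {n : ℕ} (p : Fin (n + 1)) (τ : Perm (Fin n)) : Perm (Fin (n + 1)) :=
  Perm.decomposeFin.symm (0, τ) * p.cycleRange

theorem insertZero_self {n : ℕ} (p : Fin (n + 1)) (τ : Perm (Fin n)) : insertZero p τ p = 0 := by
  simp [insertZero]

theorem insertZero_succAbove {n : ℕ} (p : Fin (n + 1)) (τ : Perm (Fin n)) (i : Fin n) :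
    insertZero p τ (p.succAbove i) = (τ i).succ := by
  simp [insertZero]

theorem sign_insertZero {n : ℕ} (p : Fin (n + 1)) (τ : Perm (Fin n)) :
    Perm.sign (insertZero p τ) = (-1) ^ (p : ℕ) * Perm.sign τ := by
  simp [insertZero, mul_comm]

theorem insertZero_mem_unshuffles {n : ℕ} (p : Fin (n + 1)) (τ : Perm (Fin n)) :
    insertZero p τ ∈ Unshuffles (n + 1) p ↔ τ ∈ Unshuffles n p := by
  have hlt {i : Fin n} (h : (i : ℕ) < p) : (p.succAbove i : ℕ) = i := by
    rw [Fin.succAbove_of_castSucc_lt _ _ (by simpa [Fin.lt_def] using h)]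
    simp
  have hge {i : Fin n} (h : (p : ℕ) ≤ i) : (p.succAbove i : ℕ) = i + 1 := by
    rw [Fin.succAbove_of_le_castSucc _ _ (by simpa [Fin.le_def] using h)]
    simp
  rw [mem_unshuffles_s16, mem_unshuffles_s16]
  constructor
  · rintro ⟨h₁, h₂⟩
    constructor
    · intro i j hij hj
      have := h₁ (p.succAbove i) (p.succAbove j) (by rw [hlt hj, hlt (hij.trans hj)]; exact hij)
        (by rw [hlt hj]; exact hj)
      rwa [insertZero_succAbove, insertZero_succAbove, Fin.succ_lt_succ_iff] at this
    · intro i j hij hi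
      have := h₂ (p.succAbove i) (p.succAbove j) (by rw [hge hi, hge (hi.trans hij.le)]; omega)
        (by rw [hge hi]; omega)
      rwa [insertZero_succAbove, insertZero_succAbove, Fin.succ_lt_succ_iff] at this
  · rintro ⟨h₁, h₂⟩
    constructor
    · intro i j hij hj
      obtain ⟨i, rfl⟩ := Fin.exists_succAbove_eq (show i ≠ p by intro h; subst h; omega)
      obtain ⟨j, rfl⟩ := Fin.exists_succAbove_eq (show j ≠ p by intro h; subst h; omega)
      have hj' : (j : ℕ) < p := by
        by_contra h
        rw [hge (by omega)] at hj
        omega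
      rw [hlt hj'] at hij
      have hi' : (i : ℕ) < p := by
        by_contra h
        rw [hge (by omega)] at hij
        omega
      rw [hlt hi'] at hij
      rw [insertZero_succAbove, insertZero_succAbove, Fin.succ_lt_succ_iff]
      exact h₁ i j hij hj'
    · intro i j hij hi
      obtain ⟨j, rfl⟩ := Fin.exists_succAbove_eq (show j ≠ p by intro h; subst h; omega)
      rw [insertZero_succAbove]
      by_cases hip : i = p
      · subst hip
        rw [insertZero_self]
        exact Fin.succ_pos _
      · obtain ⟨i, rfl⟩ := Fin.exists_succAbove_eq hip
        have hi' : (p : ℕ) ≤ i := by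
          by_contra h
          rw [hlt (by omega)] at hi
          omega
        rw [hge hi'] at hij
        have hj' : (p : ℕ) ≤ j := by
          by_contra h
          rw [hlt (by omega)] at hij
          omega
        rw [hge hj'] at hij
        rw [insertZero_succAbove, Fin.succ_lt_succ_iff]
        exact h₂ i j (by omega) hi'

theorem decomposeFin_symm_zero_injective {n : ℕ} :
    Function.Injective fun τ : Perm (Fin n) => Perm.decomposeFin.symm (0, τ) := by
  intro τ τ' h
  simpa using h

theorem insertZero_injective {n : ℕ} (p : Fin (n + 1)) : Function.Injective (insertZero p) :=
  fun _ _ h => decomposeFin_symm_zero_injective (mul_right_cancel h)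

theorem exists_insertZero {n : ℕ} {σ : Perm (Fin (n + 1))} {p : Fin (n + 1)} (h : σ p = 0) :
    ∃ τ, insertZero p τ = σ := by
  obtain ⟨τ, hτ⟩ := exists_decomposeFin_of_apply_zero (σ := σ * p.cycleRange⁻¹)
    (by simpa using h)
  exact ⟨τ, by rw [insertZero, hτ]; simp⟩

/-- Splitting unshuffles according to the block that contains `0`. -/
theorem sum_unshuffles_succ {W : Type*} [AddCommMonoid W] {n p : ℕ}
    (f : Perm (Fin (n + 1)) → W) :
    ∑ σ ∈ Unshuffles (n + 1) p, f σ =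
      (if 1 ≤ p then ∑ τ ∈ Unshuffles n (p - 1), f (Perm.decomposeFin.symm (0, τ)) else 0) +
        if h : p < n + 1 then ∑ τ ∈ Unshuffles n p, f (insertZero ⟨p, h⟩ τ) else 0 := by
  rw [← Finset.sum_filter_add_sum_filter_not _ (fun σ : Perm (Fin (n + 1)) => (σ⁻¹ 0 : ℕ) < p)]
  have hfirst {σ : Perm (Fin (n + 1))} (hσ : σ ∈ Unshuffles (n + 1) p)
      (h : (σ⁻¹ 0 : ℕ) < p) : σ 0 = 0 := by
    by_contra h0
    have hpos : (0 : ℕ) < (σ⁻¹ 0 : Fin (n + 1)) := by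
      rcases Nat.eq_zero_or_pos (σ⁻¹ 0 : Fin (n + 1)) with h' | h'
      · exact (h0 (Perm.inv_eq_iff_eq.mp (Fin.ext h')).symm).elim
      · exact h'
    have := (mem_unshuffles_s16.mp hσ).1 0 (σ⁻¹ 0) (by simpa using hpos) h
    simp at this
  have hsecond {σ : Perm (Fin (n + 1))} (hσ : σ ∈ Unshuffles (n + 1) p)
      (h : ¬(σ⁻¹ 0 : ℕ) < p) : (σ⁻¹ 0 : ℕ) = p := by
    by_contra h0
    have hp : p < n + 1 := by omega
    have := (mem_unshuffles_s16.mp hσ).2 ⟨p, hp⟩ (σ⁻¹ 0)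
      (by change p < ((σ⁻¹ 0 : Fin (n + 1)) : ℕ); omega) le_rfl
    simp at this
  congr 1
  · split_ifs with hp
    · obtain ⟨p, rfl⟩ := Nat.exists_eq_add_of_le' hp
      symm
      apply Finset.sum_bij fun τ _ => Perm.decomposeFin.symm (0, τ)
      · intro τ hτ
        rw [Finset.mem_filter]
        refine ⟨(decomposeFin_symm_mem_unshuffles τ).mpr hτ, ?_⟩
        have : (Perm.decomposeFin.symm (0, τ))⁻¹ 0 = 0 := by
          rw [Perm.inv_eq_iff_eq]
          simp
        rw [this]
        simp
      · intro τ _ τ' _ h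
        exact decomposeFin_symm_zero_injective h
      · intro σ hσ
        rw [Finset.mem_filter] at hσ
        obtain ⟨τ, rfl⟩ := exists_decomposeFin_of_apply_zero (hfirst hσ.1 hσ.2)
        exact ⟨τ, (decomposeFin_symm_mem_unshuffles τ).mp hσ.1, rfl⟩
      · intro τ _
        rfl
    · rw [Finset.filter_false_of_mem, Finset.sum_empty]
      intro σ _
      omega
  · split_ifs with hp
    · symm
      apply Finset.sum_bij fun τ _ => insertZero ⟨p, hp⟩ τ
      · intro τ hτ
        rw [Finset.mem_filter]
        refine ⟨(insertZero_mem_unshuffles ⟨p, hp⟩ τ).mpr hτ, ?_⟩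
        have : (insertZero ⟨p, hp⟩ τ)⁻¹ 0 = ⟨p, hp⟩ := by
          rw [Perm.inv_eq_iff_eq, insertZero_self]
        rw [this]
        simp
      · intro τ _ τ' _ h
        exact insertZero_injective _ h
      · intro σ hσ
        rw [Finset.mem_filter] at hσ
        obtain ⟨τ, rfl⟩ := exists_insertZero (σ := σ) (p := ⟨p, hp⟩) (by
          rw [eq_comm, ← Perm.inv_eq_iff_eq]
          exact Fin.ext (hsecond hσ.1 hσ.2))
        exact ⟨τ, (insertZero_mem_unshuffles ⟨p, hp⟩ τ).mp hσ.1, rfl⟩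
      · intro τ _
        rfl
    · rw [Finset.filter_false_of_mem, Finset.sum_empty]
      intro σ hσ h
      have := hsecond hσ h
      omega

theorem ofFn_decomposeFin {V : Type*} {n : ℕ} (y : Fin (n + 1) → V) (τ : Perm (Fin n)) :
    List.ofFn (y ∘ Perm.decomposeFin.symm (0, τ)) = y 0 :: List.ofFn ((y ∘ Fin.succ) ∘ τ) := by
  rw [List.ofFn_succ]
  congr 1

theorem insertZero_apply_of_lt {n : ℕ} (p : Fin (n + 1)) (τ : Perm (Fin n)) {i : ℕ}
    (hi : i < n + 1) (h : i < p) :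
    insertZero p τ ⟨i, hi⟩ = (τ ⟨i, by omega⟩).succ := by
  rw [← insertZero_succAbove p, Fin.succAbove_of_castSucc_lt _ _ (by simpa [Fin.lt_def] using h)]
  rfl

theorem insertZero_apply_of_gt {n : ℕ} (p : Fin (n + 1)) (τ : Perm (Fin n)) {i : ℕ}
    (hi : i + 1 < n + 1) (h : (p : ℕ) ≤ i) :
    insertZero p τ ⟨i + 1, hi⟩ = (τ ⟨i, by omega⟩).succ := by
  rw [← insertZero_succAbove p, Fin.succAbove_of_le_castSucc _ _ (by simpa [Fin.le_def] using h)]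
  rfl

theorem take_ofFn_insertZero {V : Type*} {n : ℕ} (y : Fin (n + 1) → V) (p : Fin (n + 1))
    (τ : Perm (Fin n)) :
    (List.ofFn (y ∘ insertZero p τ)).take p = (List.ofFn ((y ∘ Fin.succ) ∘ τ)).take p := by
  apply List.ext_getElem
  · simp
    omega
  · intro i h₁ h₂
    simp only [List.length_take, List.length_ofFn, lt_inf_iff] at h₁
    simp [-List.ofFn_succ, insertZero_apply_of_lt p τ h₁.2 h₁.1]

theorem drop_ofFn_insertZero {V : Type*} {n : ℕ} (y : Fin (n + 1) → V) (p : Fin (n + 1))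
    (τ : Perm (Fin n)) :
    (List.ofFn (y ∘ insertZero p τ)).drop p = y 0 :: (List.ofFn ((y ∘ Fin.succ) ∘ τ)).drop p := by
  apply List.ext_getElem
  · simp
    omega
  · intro i h₁ h₂
    simp only [List.length_drop, List.length_ofFn] at h₁
    cases i with
    | zero => simp [-List.ofFn_succ, insertZero_self]
    | succ i =>
      have := insertZero_apply_of_gt p τ (i := p + i) (by omega) (by omega)
      simpa [-List.ofFn_succ, add_assoc] using congrArg y this

/-- The shuffle product as a sum over unshuffles. -/
theorem shuf_ofFn {V X Y W : Type*} [AddCommGroup X] [AddCommGroup W] (m : X → Y → W)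
    {n : ℕ} (F : List V → X) (G : List V → Y)
    (hm : ∀ l, ∃ φ : X →+ W, ∀ u, m u (G l) = φ u) (y : Fin n → V) :
    shuf m F G (List.ofFn y) = ∑ p ∈ Finset.range (n + 1), ∑ σ ∈ Unshuffles n p,
      ((Perm.sign σ : ℤˣ) : ℤ) •
        m (F ((List.ofFn (y ∘ σ)).take p)) (G ((List.ofFn (y ∘ σ)).drop p)) := by
  induction n generalizing F G with
  | zero =>
    have : Unshuffles 0 0 = {1} := by
      ext σ
      simp [mem_unshuffles_s16, Subsingleton.elim σ 1]
    simp [this, shuf]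
  | succ n ih =>
    rw [List.ofFn_succ]
    change shuf m (ctr (y 0) F) G (List.ofFn (y ∘ Fin.succ)) +
      shuf m (eps F) (ctr (y 0) G) (List.ofFn (y ∘ Fin.succ)) = _
    rw [ih _ _ hm, ih (eps F) (ctr (y 0) G) fun l => hm (y 0 :: l)]
    simp only [sum_unshuffles_succ]
    rw [Finset.sum_add_distrib]
    congr 1
    · rw [Finset.sum_range_succ' _ (n + 1)]
      simp only [le_add_iff_nonneg_left, zero_le, if_true, Nat.add_sub_cancel,
        decomposeFin_symm_zero_sign, ofFn_decomposeFin]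
      simp [ctr]
    · rw [Finset.sum_range_succ _ (n + 1), dif_neg (lt_irrefl _), add_zero]
      apply Finset.sum_congr rfl
      intro p hp
      rw [Finset.mem_range] at hp
      rw [dif_pos hp]
      apply Finset.sum_congr rfl
      intro τ _
      have h₁ := take_ofFn_insertZero y ⟨p, hp⟩ τ
      have h₂ := drop_ofFn_insertZero y ⟨p, hp⟩ τ
      simp only at h₁ h₂
      rw [h₁, h₂, sign_insertZero]
      set l := List.ofFn ((y ∘ Fin.succ) ∘ τ) with hl
      obtain ⟨φ, hφ⟩ := hm (y 0 :: l.drop p)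
      have hlen : (l.take p).length = p := by
        simp [hl]
        omega
      simp only [ctr, eps, hφ, hlen, map_zsmul, smul_smul, Units.val_mul, mul_comm]

theorem shuf_ofFn_of_hasArity {V X Y W : Type*} [AddCommGroup X] [AddCommGroup W]
    (m : X → Y → W) {n p : ℕ} (hp : p ≤ n) {F : List V → X} (hF : HasArity p F) (G : List V → Y)
    (hm : ∀ l, ∃ φ : X →+ W, ∀ u, m u (G l) = φ u) (y : Fin n → V) :
    shuf m F G (List.ofFn y) = ∑ σ ∈ Unshuffles n p, ((Perm.sign σ : ℤˣ) : ℤ) •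
      m (F ((List.ofFn (y ∘ σ)).take p)) (G ((List.ofFn (y ∘ σ)).drop p)) := by
  rw [shuf_ofFn m F G hm, Finset.sum_eq_single_of_mem p (by simp; omega)]
  intro q hq hqp
  rw [Finset.mem_range] at hq
  apply Finset.sum_eq_zero
  intro σ _
  obtain ⟨φ, hφ⟩ := hm ((List.ofFn (y ∘ σ)).drop q)
  rw [hφ, hF _ (by simp; omega), map_zero, smul_zero]

end Unshuffle

/-! ### Operations as functions on lists -/

section Transfer

/-- The function on lists supported in length `n` that is encoded by an `n`-ary operation. -/
def toList {V : Type*} [Zero V] (n : ℕ) (A : Op V) : List V → V := fun l =>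
  if l.length = n then A fun i => l.getD i 0 else 0

/-- The list of the first `n` entries of a sequence. -/
def initial {V : Type*} (n : ℕ) (x : ℕ → V) : List V := List.ofFn fun i : Fin n => x i

theorem initial_getD {V : Type*} [Zero V] (l : List V) :
    initial l.length (fun i => l.getD i 0) = l := by
  apply List.ext_getElem
  · simp [initial]
  · intro i h₁ h₂
    simp [initial]

theorem toList_hasArity {V : Type*} [Zero V] (n : ℕ) (A : Op V) : HasArity n (toList n A) := by
  intro l hl
  exact if_neg fun h => hl (by rw [h])

theorem toList_add {V : Type*} [AddCommGroup V] (n : ℕ) (A B : Op V) :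
    toList n (A + B) = toList n A + toList n B := by
  funext l
  by_cases h : l.length = n <;> simp [toList, h]

theorem toList_zsmul {V : Type*} [AddCommGroup V] (n : ℕ) (c : ℤ) (A : Op V) :
    toList n (c • A) = c • toList n A := by
  funext l
  by_cases h : l.length = n <;> simp [toList, h]

/-- A function on lists of arity `n` is determined by its values on initial segments. -/
theorem toList_eq_of_forall_initial {V : Type*} [Zero V] {n : ℕ} {A : Op V} {F : List V → V}
    (hF : HasArity n F) (h : ∀ x, A x = F (initial n x)) : toList n A = F := by
  funext l
  by_cases hl : l.length = n
  · subst hl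
    rw [toList, if_pos rfl, h, initial_getD]
  · rw [toList, if_neg hl, hF l (by exact_mod_cast hl)]

theorem toList_take_ofFn {V : Type*} [Zero V] {n p : ℕ} (hp : p ≤ n) (A : Op V) (z : Fin n → V) :
    toList p A ((List.ofFn z).take p) =
      A fun i => if hi : i < p then z ⟨i, by omega⟩ else 0 := by
  rw [toList, if_pos (by simp [hp])]
  congr 1
  funext i
  by_cases hi : i < p
  · have : i < n := by omega
    simp [-List.ofFn_succ, hi, this]
  · simp [-List.ofFn_succ, hi]

theorem wedge_apply {V : Type*} [CommRing V] (p q : ℕ) (A B : Op V) (x : ℕ → V) :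
    wedge p q A B x = wdg (toList p A) (toList q B) (initial (p + q) x) := by
  rw [wdg, initial, shuf_ofFn_of_hasArity (fun u v : V => u * v) (by omega) (toList_hasArity p A) _
    fun l => ⟨AddMonoidHom.mulRight (toList q B l), fun u => rfl⟩, wedge]
  apply Finset.sum_congr rfl
  intro σ _
  rw [toList_take_ofFn (by omega)]
  congr 2
  rw [toList, if_pos (by simp)]
  congr 1
  funext i
  by_cases hi : i < q <;> simp [-List.ofFn_succ, hi]

theorem toList_wedge {V : Type*} [CommRing V] {n p q : ℕ} (h : n = p + q) (A B : Op V) :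
    toList n (wedge p q A B) = wdg (toList p A) (toList q B) := by
  subst h
  apply toList_eq_of_forall_initial
  · rw [Nat.cast_add]
    exact (toList_hasArity p A).wdg (toList_hasArity q B)
  · exact wedge_apply p q A B

theorem nrIns_apply {V : Type*} [AddCommGroup V] {n p q : ℕ} {A : Op V}
    (h : n + 1 = p + q) (hA : Additive (toList p A)) (B : Op V) (x : ℕ → V) :
    nrIns p q A B x = ins (toList q B) (toList p A) (initial n x) := by
  rcases p with _ | p
  · have hcons (l : List V) (u : V) : toList 0 A (u :: l) = (0 : List V → V) (u :: l) := by
      simp [toList]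
    have hzero : ins (toList q B) (toList 0 A) = ins (toList q B) 0 := by
      unfold ins
      simp only [hcons]
    have := ins_zsmul_right 0 (toList q B) 0
    rw [zero_smul, zero_smul] at this
    rw [hzero, this, nrIns, dif_pos rfl]
    rfl
  · obtain rfl : n = p + 1 + q - 1 := by omega
    rw [ins, initial, shuf_ofFn_of_hasArity (p := q) (fun (u : V) (g : V → V) => g u) (by omega)
      (toList_hasArity q B) (fun l u => toList (p + 1) A (u :: l)) fun l =>
        ⟨AddMonoidHom.mk' (fun u => toList (p + 1) A (u :: l)) fun u v => hA [] u v l,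
          fun u => rfl⟩, nrIns, dif_neg (Nat.succ_ne_zero p)]
    apply Finset.sum_congr rfl
    intro σ _
    congr 1
    beta_reduce
    rw [toList_take_ofFn (by omega), toList, if_pos (by simp)]
    congr 1
    funext j
    rcases j with _ | j
    · simp
    · by_cases hj : j < p <;> simp [-List.ofFn_succ, hj]

theorem nrBracket_apply {V : Type*} [AddCommGroup V] {n : ℕ} {a b : ℤ} {A B : Op V}
    (h : n + 1 = ar a + ar b) (hA : Additive (toList (ar a) A)) (hB : Additive (toList (ar b) B))
    (x : ℕ → V) :
    nrBracket a b A B x = (-ins (toList (ar a) A) (toList (ar b) B) +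
      koszul ((-1) ^ a) ((-1) ^ b) • ins (toList (ar b) B) (toList (ar a) A)) (initial n x) := by
  have hk : (((-1 : ℤˣ) ^ (a * b) : ℤˣ) : ℤ) = koszul ((-1) ^ a) ((-1) ^ b) := by
    rw [zpow_mul]
    rcases Int.units_eq_one_or ((-1 : ℤˣ) ^ a) with ha | ha <;>
      rcases Int.units_eq_one_or ((-1 : ℤˣ) ^ b) with hb | hb <;> simp [koszul, ha, hb]
  simp only [nrBracket, hk, Pi.add_apply, Pi.neg_apply, Pi.smul_apply]
  rw [nrIns_apply (h.trans (add_comm _ _)) hB, nrIns_apply h hA]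

theorem toList_nrBracket {V : Type*} [AddCommGroup V] {n : ℕ} {a b : ℤ} {A B : Op V}
    (h : n + 1 = ar a + ar b) (hsA : Skew (toList (ar a) A)) (hA : Additive (toList (ar a) A))
    (hsB : Skew (toList (ar b) B)) (hB : Additive (toList (ar b) B)) :
    toList n (nrBracket a b A B) = -ins (toList (ar a) A) (toList (ar b) B) +
      koszul ((-1) ^ a) ((-1) ^ b) • ins (toList (ar b) B) (toList (ar a) A) := by
  apply toList_eq_of_forall_initial
  · have h₁ := (toList_hasArity (ar a) A).ins (toList_hasArity (ar b) B) hsB hB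
    have h₂ := (toList_hasArity (ar b) B).ins (toList_hasArity (ar a) A) hsA hA
    intro l hl
    simp only [Pi.add_apply, Pi.neg_apply, Pi.smul_apply]
    rw [h₁ l (by omega), h₂ l (by omega), neg_zero, smul_zero, add_zero]
  · exact nrBracket_apply h hA hB

theorem getD_append_cons {V : Type*} [Zero V] (l₁ l₂ : List V) (u w : V) :
    (fun i => (l₁ ++ u :: l₂).getD i 0) =
      Function.update (fun i => (l₁ ++ w :: l₂).getD i 0) l₁.length u := by
  funext i
  rcases lt_trichotomy i l₁.length with h | rfl | h
  · simp [Function.update_of_ne h.ne, List.getElem?_append_left h]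
  · simp
  · obtain ⟨c, rfl⟩ := Nat.exists_eq_add_of_lt h
    rw [Function.update_of_ne (by omega)]
    simp [add_assoc, List.getElem?_append_right]

theorem IsMultilinearOn.additive_toList {k V : Type*} [Semiring k] [AddCommGroup V] [Module k V]
    {n : ℕ} {A : Op V} (h : IsMultilinearOn k n A) : Additive (toList n A) := by
  intro l₁ u v l₂
  by_cases hl : (l₁ ++ (0 : V) :: l₂).length = n
  · have hlen (w : V) : (l₁ ++ w :: l₂).length = n := by simpa using hl
    simp only [toList, hlen, if_true]
    rw [getD_append_cons l₁ l₂ (u + v) 0, getD_append_cons l₁ l₂ u 0, getD_append_cons l₁ l₂ v 0]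
    exact (h.2 l₁.length (by simp at hl; omega)).2 _ u v
  · have hlen (w : V) : ¬(l₁ ++ w :: l₂).length = n := by simpa using hl
    simp [toList, hlen, -List.length_append]

theorem skew_toList {k V : Type*} [Semiring k] [AddCommGroup V] [Module k V]
    {n : ℕ} {A : Op V} (h : IsMultilinearOn k n A) (h' : IsAlternatingOn n A) :
    Skew (toList n A) := by
  intro l₁ u v l₂
  have hadd := h.additive_toList
  have hself (w : V) : toList n A (l₁ ++ w :: w :: l₂) = 0 := by
    rw [toList]
    split_ifs with hl
    · simp only [List.length_append, List.length_cons] at hl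
      apply h' _ l₁.length (l₁.length + 1) (by omega) (by omega) (by omega)
      simp
    · rfl
  have h₁ (x y z : V) := hadd l₁ x y (z :: l₂)
  have h₂ (x y z : V) := hadd (l₁ ++ [z]) x y l₂
  simp only [List.append_assoc, List.singleton_append] at h₂
  have := hself (u + v)
  rw [h₁, h₂, h₂, hself, hself, zero_add, add_zero] at this
  exact eq_neg_of_add_eq_zero_left this

theorem MemADer.isMultiderivation {k V : Type*} [CommRing k] [CommRing V] [Algebra k V] {a : ℤ}
    {A : Op V} (h : MemADer k a A) : IsMultiderivation (toList (ar a) A) := by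
  obtain ⟨hm, ha, hd⟩ := h
  refine ⟨skew_toList hm ha, hm.additive_toList, fun u v l => ?_⟩
  have hcons (w : V) : (fun i => (w :: l).getD i 0) = consV w fun i => l.getD i 0 := by
    funext i
    rcases i with _ | i <;> simp [consV]
  by_cases hl : l.length + 1 = ar a
  · simp only [toList, List.length_cons, hl, if_true, hcons]
    exact hd (by simp only [ar] at hl; omega) u v _
  · simp [toList, hl]

end Transfer

/-- for a derivation `Z` and `Z`-homogeneous multiderivations
`A_1, A_2, B_1, B_2`,
`[A_1 + Z∧A_2, B_1 + Z∧B_2]^{NR} = [A_1,B_1] + a·A_1∧B_2 − (−1)^a b·A_2∧B_1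
+ (−1)^a Z∧[A_1,B_2] + Z∧[A_2,B_1] + (a−b)·Z∧A_2∧B_2`; consequently
`H_Z(A_1 + I∧A_2) = A_1 + Z∧A_2` is a homomorphism of the
Nijenhuis–Richardson brackets on `Z`-homogeneous elements. -/
theorem statement16 (k V : Type*) [Field k] [CharZero k]
    [CommRing V] [Algebra k V]
    (Z : Op V) (hZ : MemADer k 0 Z)
    (a b : ℤ) (ha : 0 ≤ a) (hb : 0 ≤ b)
    (A₁ A₂ B₁ B₂ : Op V)
    (hA₁ : MemADer k a A₁) (hA₂ : MemADer k (a - 1) A₂)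
    (hB₁ : MemADer k b B₁) (hB₂ : MemADer k (b - 1) B₂)
    (hZA₁ : nrBracket 0 a Z A₁ = (-a : ℤ) • A₁)
    (hZA₂ : nrBracket 0 (a - 1) Z A₂ = (-a : ℤ) • A₂)
    (hZB₁ : nrBracket 0 b Z B₁ = (-b : ℤ) • B₁)
    (hZB₂ : nrBracket 0 (b - 1) Z B₂ = (-b : ℤ) • B₂) :
    nrBracket a b (A₁ + wedge 1 (ar (a - 1)) Z A₂)
        (B₁ + wedge 1 (ar (b - 1)) Z B₂) =
      nrBracket a b A₁ B₁ +
      a • wedge (ar a) (ar (b - 1)) A₁ B₂ -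
      ((((-1 : ℤˣ) ^ a : ℤˣ) : ℤ) * b) • wedge (ar (a - 1)) (ar b) A₂ B₁ +
      (((-1 : ℤˣ) ^ a : ℤˣ) : ℤ) •
        wedge 1 (ar (a + b - 1)) Z (nrBracket a (b - 1) A₁ B₂) +
      wedge 1 (ar (a + b - 1)) Z (nrBracket (a - 1) b A₂ B₁) +
      (a - b) • wedge 1 (ar (a + b - 1)) Z
        (wedge (ar (a - 1)) (ar (b - 1)) A₂ B₂) := by
  obtain ⟨m, rfl⟩ := Int.eq_ofNat_of_zero_le ha
  obtain ⟨n, rfl⟩ := Int.eq_ofNat_of_zero_le hb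
  have ar0 : ar 0 = 1 := rfl
  have arm : ar (m : ℤ) = m + 1 := by simp [ar]
  have arn : ar (n : ℤ) = n + 1 := by simp [ar]
  have arm' : ar ((m : ℤ) - 1) = m := by simp [ar]
  have arn' : ar ((n : ℤ) - 1) = n := by simp [ar]
  have armn : ar ((m : ℤ) + n - 1) = m + n := by simp [ar]; omega
  have hV (v : V) (hv : v + v = 0) : v = 0 := by
    rw [← two_smul k] at hv
    simpa [smul_smul] using congrArg (fun w => (2⁻¹ : k) • w) hv
  have dZ := hZ.isMultiderivation
  have dA₁ := hA₁.isMultiderivation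
  have dA₂ := hA₂.isMultiderivation
  have dB₁ := hB₁.isMultiderivation
  have dB₂ := hB₂.isMultiderivation
  have sign_sub (c : ℤ) : (-1 : ℤˣ) ^ (c - 1) = -(-1) ^ c := by
    rw [zpow_sub_one]
    simp
  have hZ_bracket {p : ℕ} {c e : ℤ} {A : Op V} (hp : ar c = p)
      (dA : IsMultiderivation (toList (ar c) A)) (h : nrBracket 0 c Z A = e • A) :
      -ins (toList 1 Z) (toList p A) + ins (toList p A) (toList 1 Z) = e • toList p A := by
    subst hp
    have := congrArg (toList (ar c)) h
    rw [toList_nrBracket (by rw [ar0]; omega) dZ.skew dZ.additive dA.skew dA.additive,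
      toList_zsmul] at this
    simpa [koszul, ar0] using this
  have kA₁ := hZ_bracket arm dA₁ hZA₁
  have kA₂ := hZ_bracket arm' dA₂ hZA₂
  have kB₁ := hZ_bracket arn dB₁ hZB₁
  have kB₂ := hZ_bracket arn' dB₂ hZB₂
  have hAW : toList (m + 1) (A₁ + wedge 1 m Z A₂) =
      toList (m + 1) A₁ + wdg (toList 1 Z) (toList m A₂) := by
    rw [toList_add, toList_wedge (add_comm m 1)]
  have hBW : toList (n + 1) (B₁ + wedge 1 n Z B₂) =
      toList (n + 1) B₁ + wdg (toList 1 Z) (toList n B₂) := by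
    rw [toList_add, toList_wedge (add_comm n 1)]
  have signs (p : ℕ) (A : Op V) : HasSign ((-1) ^ (p : ℤ)) (toList p A) :=
    ⟨_, rfl, toList_hasArity p A⟩
  have signs_succ (p : ℕ) (A : Op V) : HasSign (-(-1) ^ (p : ℤ)) (toList (p + 1) A) := by
    have := signs (p + 1) A
    rwa [Nat.cast_succ, zpow_add_one, mul_neg_one] at this
  have sZ : HasSign (-1) (toList 1 Z) := by simpa using signs 1 Z
  rw [ar0] at dZ
  have aAW : Additive (toList (m + 1) (A₁ + wedge 1 m Z A₂)) := by
    rw [hAW]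
    rw [arm] at dA₁
    rw [arm'] at dA₂
    exact dA₁.additive.add (dZ.additive.wdg dA₂.additive)
  have aBW : Additive (toList (n + 1) (B₁ + wedge 1 n Z B₂)) := by
    rw [hBW]
    rw [arn] at dB₁
    rw [arn'] at dB₂
    exact dB₁.additive.add (dZ.additive.wdg dB₂.additive)
  funext x
  simp only [Pi.add_apply, Pi.sub_apply, Pi.smul_apply]
  rw [arm', arn', armn]
  rw [nrBracket_apply (n := m + n + 1) (by omega) (by rwa [arm]) (by rwa [arn]),
    nrBracket_apply (n := m + n + 1) (by omega) dA₁.additive dB₁.additive]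
  simp only [wedge_apply]
  rw [toList_nrBracket (by omega) dA₁.skew dA₁.additive dB₂.skew dB₂.additive,
    toList_nrBracket (by omega) dA₂.skew dA₂.additive dB₁.skew dB₁.additive,
    toList_wedge rfl]
  rw [arm] at dA₁ ⊢
  rw [arn] at dB₁ ⊢
  rw [arm'] at dA₂ ⊢
  rw [arn'] at dB₂ ⊢
  rw [hAW, hBW, sign_sub, sign_sub, show m + 1 + n = m + n + 1 by omega,
    show m + (n + 1) = m + n + 1 by omega, show 1 + (m + n) = m + n + 1 by omega]
  exact congrFun (bracket_add_wdg hV dZ dA₁ dA₂ dB₁ dB₂ sZ (signs_succ m A₁) (signs m A₂)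
    (signs_succ n B₁) (signs n B₂) kA₁ kA₂ kB₁ kB₂) (initial (m + n + 1) x)

end JacobiRevisited
end
end
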